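/- Let n ≥ 3 and fix a compact set 𝒦 ⊂ SL_n(ℝ). Let μ be the Haar measure on SL_n(ℝ) normalized so that a fundamental domain for the left action of SL_n(ℤ) has measure 1. Then there exists a constant C = C(𝒦, n) such that for every bounded measurable set A ⊂ ℝⁿ with vol(A) > 1 and every T > 0: μ({g ∈ 𝒦 : D(ℤⁿg, A) ≥ T}) ≤ C · vol(A)/T². -/

import Mathlib

open MeasureTheory Matrix

noncomputable section

/-- `SL_n(ℝ)`. -/
abbrev SLR (n : ℕ) := Matrix.SpecialLinearGroup (Fin n) ℝ

instance (n : ℕ) : TopologicalSpace (SLR n) :=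
  TopologicalSpace.induced (fun g => (g : Matrix (Fin n) (Fin n) ℝ)) inferInstance

instance (n : ℕ) : MeasurableSpace (SLR n) := borel _

/-- `Γ = SL_n(ℤ)`, viewed as a subgroup of `SL_n(ℝ)`. -/
def Gam (n : ℕ) : Subgroup (SLR n) :=
  MonoidHom.range (Matrix.SpecialLinearGroup.map (n := Fin n) (Int.castRingHom ℝ))

/-- The coercion `ℤⁿ → ℝⁿ`. -/
def intVec {n : ℕ} (v : Fin n → ℤ) : Fin n → ℝ := fun i => (v i : ℝ)

/-- Number of points of the lattice `ℤⁿg` lying in `A`. -/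
def latCount {n : ℕ} (g : SLR n) (A : Set (Fin n → ℝ)) : ℕ :=
  Nat.card {v : Fin n → ℤ |
    Matrix.vecMul (intVec v) (g : Matrix (Fin n) (Fin n) ℝ) ∈ A}

/-- The discrepancy `D(ℤⁿg, A) = |#(ℤⁿg ∩ A) − vol(A)|`. -/
def disc {n : ℕ} (g : SLR n) (A : Set (Fin n → ℝ)) : ℝ :=
  |(latCount g A : ℝ) - (volume A).toReal|

set_option linter.unusedSectionVars false

namespace SLR

section

variable {n : ℕ}

theorem continuous_coe : Continuous (fun g : SLR n => (g : Matrix (Fin n) (Fin n) ℝ)) :=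
  continuous_induced_dom

instance : IsTopologicalGroup (SLR n) :=
  Matrix.SpecialLinearGroup.topologicalGroup

theorem isClosedEmbedding_coe :
    Topology.IsClosedEmbedding (fun g : SLR n => (g : Matrix (Fin n) (Fin n) ℝ)) :=
  Matrix.SpecialLinearGroup.isClosedEmbedding_val

instance : T2Space (SLR n) := isClosedEmbedding_coe.isEmbedding.t2Space

instance : LocallyCompactSpace (SLR n) :=
  have : LocallyCompactSpace (Matrix (Fin n) (Fin n) ℝ) :=
    inferInstanceAs (LocallyCompactSpace (Fin n → Fin n → ℝ))
  isClosedEmbedding_coe.locallyCompactSpace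

instance : SecondCountableTopology (SLR n) :=
  have : SecondCountableTopology (Matrix (Fin n) (Fin n) ℝ) :=
    inferInstanceAs (SecondCountableTopology (Fin n → Fin n → ℝ))
  isClosedEmbedding_coe.isEmbedding.secondCountableTopology

instance : BorelSpace (SLR n) := ⟨rfl⟩

/-- The map from `SL_n(ℝ)` to functions of two indices, as a family of rows. -/
def rows (g : SLR n) : Fin n → Fin n → ℝ := fun i j => (g : Matrix (Fin n) (Fin n) ℝ) i j

theorem continuous_rows : Continuous (rows : SLR n → _) := continuous_coe

theorem isClosedEmbedding_rows : Topology.IsClosedEmbedding (rows : SLR n → _) :=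
  isClosedEmbedding_coe

theorem measurable_iff_rows {α : Type*} [MeasurableSpace α] {f : α → SLR n} :
    Measurable f ↔ Measurable fun a => rows (f a) := by
  refine ⟨fun h => continuous_rows.measurable.comp h, fun h => ?_⟩
  exact isClosedEmbedding_rows.measurableEmbedding.measurable_comp_iff.1 h

instance : Countable (Gam n) := by
  unfold Gam
  have : Countable (Matrix (Fin n) (Fin n) ℤ) := inferInstanceAs (Countable (Fin n → Fin n → ℤ))
  have : Countable (Matrix.SpecialLinearGroup (Fin n) ℤ) :=
    Subtype.val_injective (p := fun A : Matrix (Fin n) (Fin n) ℤ => A.det = 1) |>.countable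
  exact Set.countable_range _ |>.to_subtype

/-- The right action of `SL_n(ℝ)` on tuples of row vectors. -/
def act {k : ℕ} (y : Fin k → Fin n → ℝ) (g : SLR n) : Fin k → Fin n → ℝ :=
  fun i => Matrix.vecMul (y i) (g : Matrix (Fin n) (Fin n) ℝ)

/-- The inclusion of integer tuples into real tuples. -/
def intTup {k : ℕ} (v : Fin k → Fin n → ℤ) : Fin k → Fin n → ℝ := fun i => intVec (v i)

theorem act_mul {k : ℕ} (y : Fin k → Fin n → ℝ) (g h : SLR n) :
    act y (g * h) = act (act y g) h := by
  funext i
  simp [act, Matrix.vecMul_vecMul]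

theorem act_one {k : ℕ} (y : Fin k → Fin n → ℝ) : act y (1 : SLR n) = y := by
  funext i
  simp [act]

theorem continuous_act {k : ℕ} :
    Continuous fun p : (Fin k → Fin n → ℝ) × SLR n => act p.1 p.2 := by
  refine continuous_pi fun i => ?_
  exact Continuous.matrix_vecMul ((continuous_apply i).comp continuous_fst)
    (continuous_coe.comp continuous_snd)

theorem measurable_act {k : ℕ} :
    Measurable fun p : (Fin k → Fin n → ℝ) × SLR n => act p.1 p.2 :=
  continuous_act.measurable

end

section

variable {n : ℕ} {μ : Measure (SLR n)} [μ.IsHaarMeasure] {F : Set (SLR n)}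

theorem isFundamentalDomain_preimage_mul_right (hF : IsFundamentalDomain (Gam n) F μ)
    (h : SLR n) : IsFundamentalDomain (Gam n) ((fun g => g * h) ⁻¹' F) μ :=
  hF.preimage_of_equiv (quasiMeasurePreserving_mul_right μ h) (e := id) Function.bijective_id
    fun γ g => by simp [Subgroup.smul_def, mul_assoc]

theorem map_mul_right_eq_self (hF : IsFundamentalDomain (Gam n) F μ) (h1 : μ F = 1)
    (h : SLR n) : μ.map (fun g => g * h) = μ := by
  have hh : (μ.map (fun g => g * h)).IsHaarMeasure := inferInstance
  have key := Measure.isMulLeftInvariant_eq_smul (μ.map (fun g => g * h)) μ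
  set c := Measure.haarScalarFactor (μ.map (fun g => g * h)) μ
  have e : (μ.map (fun g => g * h)) F = 1 := by
    rw [Measure.map_apply₀ (by fun_prop)]
    · rw [← h1]
      exact (isFundamentalDomain_preimage_mul_right hF h).measure_eq hF
    · rw [key]
      exact hF.nullMeasurableSet.mono_ac (Measure.smul_absolutelyContinuous)
  rw [key] at e ⊢
  rw [Measure.smul_apply, h1, ENNReal.smul_def, smul_eq_mul, mul_one] at e
  have : c = 1 := by exact_mod_cast e
  rw [this, one_smul]

theorem measurePreserving_mul_right (hF : IsFundamentalDomain (Gam n) F μ) (h1 : μ F = 1)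
    (h : SLR n) : MeasurePreserving (fun g => g * h) μ μ :=
  ⟨by fun_prop, map_mul_right_eq_self hF h1 h⟩

theorem setLIntegral_mul_right (hF : IsFundamentalDomain (Gam n) F μ) (h1 : μ F = 1)
    {f : SLR n → ENNReal} (hf : ∀ (γ : Gam n) (g), f (γ * g) = f g)
    (h : SLR n) : ∫⁻ g in F, f (g * h) ∂μ = ∫⁻ g in F, f g ∂μ := by
  rw [hF.setLIntegral_eq (isFundamentalDomain_preimage_mul_right hF h)]
  · exact (measurePreserving_mul_right hF h1 h).setLIntegral_comp_preimage_emb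
      (measurableEmbedding_mulRight h) f F
  · intro γ g
    rw [Subgroup.smul_def, smul_eq_mul, mul_assoc, hf]

/-- Counting measure of the translates of a set of integer tuples, averaged over the domain `F`. -/
def tupMeas (μ : Measure (SLR n)) (F : Set (SLR n)) {k : ℕ} (I : Set (Fin k → Fin n → ℤ)) :
    Measure (Fin k → Fin n → ℝ) :=
  Measure.sum fun v : I => (μ.restrict F).map fun g => act (intTup v.1) g

/-- A set of integer tuples that is invariant under the right action of `SL_n(ℤ)`. -/
def InvTup {k : ℕ} (I : Set (Fin k → Fin n → ℤ)) : Prop :=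
  ∀ (γ : Matrix.SpecialLinearGroup (Fin n) ℤ), ∀ v ∈ I,
    (fun i => Matrix.vecMul (v i) (γ : Matrix (Fin n) (Fin n) ℤ)) ∈ I

instance {k : ℕ} (I : Set (Fin k → Fin n → ℤ)) : SFinite (tupMeas μ F I) := by
  unfold tupMeas
  infer_instance

theorem measurable_act_left {k : ℕ} (y : Fin k → Fin n → ℝ) :
    Measurable fun g : SLR n => act y g :=
  measurable_act.comp (measurable_const.prodMk measurable_id)

theorem measurable_act_right {k : ℕ} (g : SLR n) :
    Measurable fun y : Fin k → Fin n → ℝ => act y g :=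
  measurable_act.comp (measurable_id.prodMk measurable_const)

theorem lintegral_tupMeas {k : ℕ} (I : Set (Fin k → Fin n → ℤ)) {f : (Fin k → Fin n → ℝ) → ENNReal}
    (hf : Measurable f) :
    ∫⁻ y, f y ∂(tupMeas μ F I) = ∫⁻ g in F, ∑' v : I, f (act (intTup v.1) g) ∂μ := by
  unfold tupMeas
  rw [lintegral_sum_measure, lintegral_tsum]
  · exact tsum_congr fun v => lintegral_map hf (measurable_act_left _)
  · exact fun v => (hf.comp (measurable_act_left _)).aemeasurable

theorem act_intTup {k : ℕ} (v : Fin k → Fin n → ℤ) (γ : Matrix.SpecialLinearGroup (Fin n) ℤ) :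
    act (intTup v) (Matrix.SpecialLinearGroup.map (Int.castRingHom ℝ) γ) =
      intTup fun i => Matrix.vecMul (v i) (γ : Matrix (Fin n) (Fin n) ℤ) := by
  funext i j
  simp [act, intTup, intVec, Matrix.vecMul, dotProduct]

theorem tsum_act_gamma {k : ℕ} {I : Set (Fin k → Fin n → ℤ)} (hI : InvTup I)
    (f : (Fin k → Fin n → ℝ) → ENNReal) (γ : Gam n) (g : SLR n) :
    ∑' v : I, f (act (intTup v.1) (γ * g)) = ∑' v : I, f (act (intTup v.1) g) := by
  obtain ⟨_, ⟨γ, rfl⟩⟩ := γ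
  let e : I ≃ I :=
    { toFun := fun v => ⟨_, hI γ v.1 v.2⟩
      invFun := fun v => ⟨_, hI γ⁻¹ v.1 v.2⟩
      left_inv := fun v => by
        ext i j
        simp only [Matrix.vecMul_vecMul]
        rw [← Matrix.SpecialLinearGroup.coe_mul, mul_inv_cancel]
        simp
      right_inv := fun v => by
        ext i j
        simp only [Matrix.vecMul_vecMul]
        rw [← Matrix.SpecialLinearGroup.coe_mul, inv_mul_cancel]
        simp }
  rw [← e.tsum_eq (fun v => f (act (intTup v.1) g))]
  refine tsum_congr fun v => ?_
  rw [act_mul, act_intTup]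
  rfl

theorem map_act_tupMeas (hF : IsFundamentalDomain (Gam n) F μ) (h1 : μ F = 1) {k : ℕ}
    {I : Set (Fin k → Fin n → ℤ)} (hI : InvTup I) (h : SLR n) :
    (tupMeas μ F I).map (fun y => act y h) = tupMeas μ F I := by
  refine Measure.ext_of_lintegral _ fun f hf => ?_
  rw [lintegral_map hf (measurable_act_right h),
    lintegral_tupMeas I (f := fun y => f (act y h)) (hf.comp (measurable_act_right h)),
      lintegral_tupMeas I hf]
  simp only [← act_mul]
  exact setLIntegral_mul_right hF h1 (f := fun g => ∑' v : I, f (act (intTup v.1) g))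
    (tsum_act_gamma hI f) h

end

section

variable {k : ℕ}

/-- The determinant of the square matrix with first row `p.1` and the other rows `p.2`. -/
def consDet (p : (Fin (k + 1) → ℝ) × (Fin k → Fin (k + 1) → ℝ)) : ℝ :=
  Matrix.det (Matrix.of (Fin.cons p.1 p.2 : Fin (k + 1) → Fin (k + 1) → ℝ))

theorem continuous_finCons {α : Type*} [TopologicalSpace α] {m : ℕ} :
    Continuous fun p : α × (Fin m → α) => (Fin.cons p.1 p.2 : Fin (m + 1) → α) :=
  Continuous.finCons continuous_fst continuous_snd

theorem continuous_consDet : Continuous (consDet (k := k)) := by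
  have h : Continuous fun p : (Fin (k + 1) → ℝ) × (Fin k → Fin (k + 1) → ℝ) =>
      Matrix.of (Fin.cons p.1 p.2 : Fin (k + 1) → Fin (k + 1) → ℝ) := continuous_finCons
  exact h.matrix_det

theorem det_cons_smul (c : ℝ) (z : Fin (k + 1) → ℝ) (y : Fin k → Fin (k + 1) → ℝ) :
    consDet (c • z, y) = c * consDet (z, y) := by
  have h : (Matrix.of (Fin.cons (c • z) y : Fin (k + 1) → Fin (k + 1) → ℝ)) =
      (Matrix.of (Fin.cons z y : Fin (k + 1) → Fin (k + 1) → ℝ)).updateRow 0 (c • z) := by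
    ext i j
    refine Fin.cases ?_ (fun i => ?_) i <;> simp
  have h2 : (Matrix.of (Fin.cons z y : Fin (k + 1) → Fin (k + 1) → ℝ)) =
      (Matrix.of (Fin.cons z y : Fin (k + 1) → Fin (k + 1) → ℝ)).updateRow 0 z := by
    ext i j
    refine Fin.cases ?_ (fun i => ?_) i <;> simp
  unfold consDet
  dsimp only
  rw [h, Matrix.det_updateRow_smul, ← h2]

/-- The right translate of a single row vector. -/
def vact {n : ℕ} (z : Fin n → ℝ) (g : SLR n) : Fin n → ℝ :=
  Matrix.vecMul z (g : Matrix (Fin n) (Fin n) ℝ)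

theorem det_cons_act (z : Fin (k + 1) → ℝ) (y : Fin k → Fin (k + 1) → ℝ) (g : SLR (k + 1)) :
    consDet (vact z g, act y g) = consDet (z, y) := by
  have h : (Matrix.of (Fin.cons (vact z g) (act y g) : Fin (k + 1) → Fin (k + 1) → ℝ)) =
      (Matrix.of (Fin.cons z y : Fin (k + 1) → Fin (k + 1) → ℝ)) *
        (g : Matrix (Fin (k + 1)) (Fin (k + 1)) ℝ) := by
    ext i j
    refine Fin.cases ?_ (fun i => ?_) i <;>
    simp [vact, act, Matrix.mul_apply, Matrix.vecMul, dotProduct]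
  unfold consDet
  dsimp only
  rw [h, Matrix.det_mul, g.2, mul_one]

/-- The special linear matrix obtained from a nonsingular one by rescaling the first row. -/
def normSL (p : (Fin (k + 1) → ℝ) × (Fin k → Fin (k + 1) → ℝ)) (h : consDet p ≠ 0) :
    SLR (k + 1) :=
  ⟨Matrix.of (Fin.cons ((consDet p)⁻¹ • p.1) p.2), by
    have := det_cons_smul (consDet p)⁻¹ p.1 p.2
    rw [inv_mul_cancel₀ h] at this
    exact this⟩

open Classical in
/-- The inverse of the simply transitive orbit map of `ℝˣ × SL` on nonsingular matrices. -/
def toPair (p : (Fin (k + 1) → ℝ) × (Fin k → Fin (k + 1) → ℝ)) : ℝˣ × SLR (k + 1) :=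
  if h : consDet p = 0 then 1 else
    (Units.mk0 (consDet p) h, (normSL p h)⁻¹)

/-- The orbit map of `ℝˣ × SL` on nonsingular matrices. -/
def ofPair (q : ℝˣ × SLR (k + 1)) : (Fin (k + 1) → ℝ) × (Fin k → Fin (k + 1) → ℝ) :=
  ((q.1 : ℝ) • rows q.2⁻¹ 0, fun i => rows q.2⁻¹ i.succ)

theorem consDet_ofPair (q : ℝˣ × SLR (k + 1)) : consDet (ofPair q) = q.1 := by
  unfold ofPair
  rw [det_cons_smul]
  have : (Matrix.of (Fin.cons (rows q.2⁻¹ 0) (fun i => rows q.2⁻¹ i.succ) :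
      Fin (k + 1) → Fin (k + 1) → ℝ)) = (q.2⁻¹ : SLR (k + 1)).1 := by
    ext i j
    refine Fin.cases ?_ (fun i => ?_) i <;> rfl
  unfold consDet
  dsimp only
  rw [this, (q.2⁻¹).2, mul_one]

theorem ofPair_toPair {p : (Fin (k + 1) → ℝ) × (Fin k → Fin (k + 1) → ℝ)} (h : consDet p ≠ 0) :
    ofPair (toPair p) = p := by
  unfold toPair ofPair
  rw [dif_neg h]
  dsimp only
  rw [inv_inv]
  refine Prod.ext ?_ ?_
  · funext j
    simp [rows, normSL, h]
  · rfl

theorem toPair_ofPair (q : ℝˣ × SLR (k + 1)) : toPair (ofPair q) = q := by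
  have h : consDet (ofPair q) ≠ 0 := by
    rw [consDet_ofPair]
    exact q.1.ne_zero
  unfold toPair
  rw [dif_neg h]
  refine Prod.ext ?_ ?_
  · ext
    simp [consDet_ofPair]
  · dsimp only
    rw [inv_eq_iff_eq_inv]
    ext i j
    simp only [normSL, consDet_ofPair, Matrix.of_apply]
    refine Fin.cases ?_ (fun i => ?_) i
    · simp [ofPair, rows]
    · simp [ofPair, rows]

theorem ofPair_mul (q r : ℝˣ × SLR (k + 1)) :
    ofPair (q * r) = ((q.1 : ℝ) • vact (ofPair r).1 q.2⁻¹, act (ofPair r).2 q.2⁻¹) := by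
  unfold ofPair
  refine Prod.ext ?_ ?_
  · ext j
    simp only [rows, vact, Prod.fst_mul, Prod.snd_mul, Units.val_mul, _root_.mul_inv_rev,
      Pi.smul_apply,
      smul_eq_mul, Matrix.SpecialLinearGroup.coe_mul, Matrix.mul_apply, Matrix.vecMul, dotProduct,
      Finset.mul_sum]
    exact Finset.sum_congr rfl fun i _ => by ring
  · funext i j
    simp only [rows, act, Prod.snd_mul, _root_.mul_inv_rev, Matrix.SpecialLinearGroup.coe_mul,
      Matrix.mul_apply, Matrix.vecMul, dotProduct]

theorem mul_toPair (q : ℝˣ × SLR (k + 1)) {p : (Fin (k + 1) → ℝ) × (Fin k → Fin (k + 1) → ℝ)}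
    (h : consDet p ≠ 0) :
    q * toPair p = toPair ((q.1 : ℝ) • vact p.1 q.2⁻¹, act p.2 q.2⁻¹) := by
  rw [← toPair_ofPair (q * toPair p), ofPair_mul, ofPair_toPair h]

theorem measurable_ofPair : Measurable (ofPair (k := k)) := by
  have h1 : Measurable fun q : ℝˣ × SLR (k + 1) => rows q.2⁻¹ :=
    continuous_rows.measurable.comp (measurable_inv.comp measurable_snd)
  have h2 : Measurable fun q : ℝˣ × SLR (k + 1) => (q.1 : ℝ) :=
    (comap_measurable _).comp measurable_fst
  refine Measurable.prodMk ?_ ?_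
  · exact h2.smul ((measurable_pi_apply 0).comp h1)
  · exact measurable_pi_lambda _ fun i => (measurable_pi_apply i.succ).comp h1

/-- The adjugate of a family of rows. -/
def adjRows {n : ℕ} (M : Fin n → Fin n → ℝ) : Fin n → Fin n → ℝ :=
  fun i j => (Matrix.of M).adjugate i j

theorem continuous_adjRows {n : ℕ} : Continuous (adjRows (n := n)) := by
  have h : Continuous fun M : Fin n → Fin n → ℝ => (Matrix.of M : Matrix (Fin n) (Fin n) ℝ) :=
    continuous_id
  exact h.matrix_adjugate

/-- Adding a row on top of a family of rows. -/
def consRows (p : (Fin (k + 1) → ℝ) × (Fin k → Fin (k + 1) → ℝ)) : Fin (k + 1) → Fin (k + 1) → ℝ :=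
  Fin.cons p.1 p.2

theorem measurable_adjRows_consRows : Measurable fun p => adjRows (consRows (k := k) p) := by
  have h : Continuous (consRows (k := k)) := continuous_finCons
  exact (continuous_adjRows.comp h).measurable

theorem measurable_toPair : Measurable (toPair (k := k)) := by
  have hd : Measurable (consDet (k := k)) := continuous_consDet.measurable
  have hs : MeasurableSet {p | consDet (k := k) p = 0} := hd (measurableSet_singleton 0)
  have h1 : Measurable fun p => (toPair (k := k) p).1 := by
    refine measurable_comap_iff.2 ?_
    have : (Units.val ∘ fun p => (toPair (k := k) p).1) =
        {p | consDet (k := k) p = 0}.piecewise (fun _ => 1) consDet := by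
      funext p
      by_cases h : consDet p = 0 <;> simp [toPair, h, Set.piecewise]
    rw [this]
    exact Measurable.piecewise hs measurable_const hd
  have h2 : Measurable fun p => (toPair (k := k) p).2 := by
    rw [measurable_iff_rows]
    have : (fun p => rows (toPair (k := k) p).2) =
        {p | consDet (k := k) p = 0}.piecewise (fun _ => rows 1) (fun p =>
          adjRows (consRows ((consDet p)⁻¹ • p.1, p.2))) := by
      funext p
      by_cases h : consDet p = 0
      · simp [toPair, h, Set.piecewise]
      · rw [Set.piecewise_eq_of_notMem (s := {p | consDet (k := k) p = 0}) _ _ h]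
        simp only [toPair, h, dite_false]
        rfl
    rw [this]
    refine Measurable.piecewise hs measurable_const ?_
    have e2 : Measurable fun p : (Fin (k + 1) → ℝ) × (Fin k → Fin (k + 1) → ℝ) =>
        (((consDet p)⁻¹ • p.1, p.2) : (Fin (k + 1) → ℝ) × (Fin k → Fin (k + 1) → ℝ)) :=
      (hd.inv.smul measurable_fst).prodMk measurable_snd
    exact measurable_adjRows_consRows.comp e2
  exact h1.prodMk h2

end

section

variable {k n : ℕ}

theorem measurable_unitsVal : Measurable (Units.val : ℝˣ → ℝ) := comap_measurable _

instance : MeasurableMul₂ (ℝˣ × SLR n) := by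
  refine ⟨?_⟩
  have h1 : Measurable fun p : (ℝˣ × SLR n) × (ℝˣ × SLR n) => p.1.1 * p.2.1 :=
    measurable_comap_iff.2 ((measurable_unitsVal.comp (measurable_fst.comp measurable_fst)).mul
      (measurable_unitsVal.comp (measurable_fst.comp measurable_snd)))
  have h2 : Measurable fun p : (ℝˣ × SLR n) × (ℝˣ × SLR n) => p.1.2 * p.2.2 :=
    (measurable_snd.comp measurable_fst).mul (measurable_snd.comp measurable_snd)
  exact h1.prodMk h2

instance : MeasurableInv (ℝˣ × SLR n) := by
  refine ⟨?_⟩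
  have h1 : Measurable fun p : ℝˣ × SLR n => p.1⁻¹ := by
    refine measurable_comap_iff.2 ?_
    have : (Units.val ∘ fun p : ℝˣ × SLR n => p.1⁻¹) = fun p => ((p.1 : ℝ))⁻¹ := by
      funext p
      simp
    rw [this]
    exact (measurable_unitsVal.comp measurable_fst).inv
  exact h1.prodMk measurable_snd.inv

theorem map_smul_vact (s : ℝˣ) (g : SLR n) :
    (volume : Measure (Fin n → ℝ)).map (fun z => (s : ℝ) • vact z g) =
      ENNReal.ofReal (|(s : ℝ)| ^ n)⁻¹ • volume := by
  have hd : Matrix.det ((s : ℝ) • (g : Matrix (Fin n) (Fin n) ℝ)ᵀ) = (s : ℝ) ^ n := by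
    rw [Matrix.det_smul, Matrix.det_transpose, g.2]
    simp
  have h := Real.map_matrix_volume_pi_eq_smul_volume_pi
    (M := (s : ℝ) • (g : Matrix (Fin n) (Fin n) ℝ)ᵀ) (by rw [hd]; exact pow_ne_zero _ s.ne_zero)
  rw [hd] at h
  have e : (fun z => (s : ℝ) • vact z g) =
      Matrix.toLin' ((s : ℝ) • (g : Matrix (Fin n) (Fin n) ℝ)ᵀ) := by
    funext z
    rw [Matrix.toLin'_apply, Matrix.smul_mulVec, Matrix.mulVec_transpose]
    rfl
  rw [e, h, abs_inv, abs_pow]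

theorem measurable_vact (g : SLR n) : Measurable fun z => vact z g :=
  (Continuous.matrix_vecMul continuous_id continuous_const).measurable

theorem measurePreserving_vact (g : SLR n) :
    MeasurePreserving (fun z => vact z g) volume volume := by
  refine ⟨measurable_vact g, ?_⟩
  simpa using map_smul_vact 1 g

theorem measurePreserving_act {m : ℕ} (g : SLR n) :
    MeasurePreserving (fun y : Fin m → Fin n → ℝ => act y g) volume volume :=
  volume_preserving_pi fun _ => measurePreserving_vact g

/-- The density `|det|⁻ⁿ`. -/
def detWeight (p : (Fin (k + 1) → ℝ) × (Fin k → Fin (k + 1) → ℝ)) : ENNReal :=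
  ENNReal.ofReal (|consDet p| ^ (k + 1))⁻¹

theorem measurable_detWeight : Measurable (detWeight (k := k)) :=
  ((continuous_consDet.measurable.abs.pow_const _).inv).ennreal_ofReal

/-- The measure on `ℝˣ × SL` attached to an invariant measure on tuples. -/
def pairMeas (β : Measure (Fin k → Fin (k + 1) → ℝ)) : Measure (ℝˣ × SLR (k + 1)) :=
  ((volume.prod β).withDensity detWeight).map toPair

instance (β : Measure (Fin k → Fin (k + 1) → ℝ)) [SFinite β] : SFinite (pairMeas β) := by
  unfold pairMeas
  infer_instance

theorem lintegral_pairMeas (β : Measure (Fin k → Fin (k + 1) → ℝ))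
    {f : ℝˣ × SLR (k + 1) → ENNReal} (hf : Measurable f) :
    ∫⁻ q, f q ∂(pairMeas β) = ∫⁻ p, detWeight p * f (toPair p) ∂(volume.prod β) := by
  unfold pairMeas
  rw [lintegral_map hf measurable_toPair,
    lintegral_withDensity_eq_lintegral_mul (g := fun p => f (toPair p)) _ measurable_detWeight
      (hf.comp measurable_toPair)]
  rfl

theorem map_prod_act {β : Measure (Fin k → Fin (k + 1) → ℝ)} [SFinite β]
    (hβ : ∀ h, β.map (fun y => act y h) = β) (q : ℝˣ × SLR (k + 1)) :
    (volume.prod β).map (fun p => ((q.1 : ℝ) • vact p.1 q.2⁻¹, act p.2 q.2⁻¹)) =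
      ENNReal.ofReal (|(q.1 : ℝ)| ^ (k + 1))⁻¹ • volume.prod β := by
  have h := Measure.map_prod_map (volume : Measure (Fin (k + 1) → ℝ)) β
    (f := fun z => (q.1 : ℝ) • vact z q.2⁻¹) (g := fun y => act y q.2⁻¹)
    ((measurable_vact _).const_smul (q.1 : ℝ)) (measurable_act_right _)
  rw [map_smul_vact, hβ, Measure.prod_smul_left] at h
  exact h.symm

theorem isMulLeftInvariant_pairMeas {β : Measure (Fin k → Fin (k + 1) → ℝ)} [SFinite β]
    (hβ : ∀ h, β.map (fun y => act y h) = β) : (pairMeas β).IsMulLeftInvariant := by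
  refine ⟨fun q => Measure.ext_of_lintegral _ fun f hf => ?_⟩
  have hq : Measurable fun r : ℝˣ × SLR (k + 1) => q * r := measurable_const_mul q
  rw [lintegral_map hf hq, lintegral_pairMeas β hf,
    lintegral_pairMeas β (f := fun r => f (q * r)) (hf.comp hq)]
  set A := fun p : (Fin (k + 1) → ℝ) × (Fin k → Fin (k + 1) → ℝ) =>
    ((q.1 : ℝ) • vact p.1 q.2⁻¹, act p.2 q.2⁻¹) with hA
  have hAm : Measurable A :=
    (((measurable_vact _).const_smul (q.1 : ℝ)).comp measurable_fst).prodMk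
      ((measurable_act_right _).comp measurable_snd)
  have hdA : ∀ p, consDet (A p) = q.1 * consDet p := fun p => by
    rw [hA]
    dsimp only
    rw [det_cons_smul, det_cons_act]
  have e : ∀ p, detWeight p * f (q * toPair p) =
      ENNReal.ofReal (|(q.1 : ℝ)| ^ (k + 1)) * (detWeight (A p) * f (toPair (A p))) := by
    intro p
    by_cases hp : consDet p = 0
    · simp [detWeight, hdA, hp]
    · rw [mul_toPair q hp, ← mul_assoc]
      congr 1
      have hs : (0 : ℝ) < |(q.1 : ℝ)| ^ (k + 1) := pow_pos (abs_pos.2 q.1.ne_zero) _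
      rw [detWeight, detWeight, hdA, ← ENNReal.ofReal_mul hs.le, abs_mul, mul_pow, mul_inv,
        mul_inv_cancel_left₀ hs.ne']
  have hG : Measurable fun p => detWeight (k := k) p * f (toPair p) :=
    measurable_detWeight.mul (hf.comp measurable_toPair)
  simp_rw [e]
  have hGA := lintegral_map (μ := volume.prod β) hG hAm
  rw [lintegral_const_mul (f := fun p => detWeight (A p) * f (toPair (A p))) _ (hG.comp hAm),
    ← hGA, map_prod_act hβ, lintegral_smul_measure, smul_eq_mul, ← mul_assoc,
      ← ENNReal.ofReal_mul (by positivity),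
    mul_inv_cancel₀ (pow_ne_zero _ (abs_ne_zero.2 q.1.ne_zero)), ENNReal.ofReal_one, one_mul]

theorem lintegral_prod_eq_pairMeas (β : Measure (Fin k → Fin (k + 1) → ℝ))
    (h0 : ∀ᵐ p ∂(volume.prod β), consDet p ≠ 0)
    {f : (Fin (k + 1) → ℝ) × (Fin k → Fin (k + 1) → ℝ) → ENNReal} (hf : Measurable f) :
    ∫⁻ p, f p ∂(volume.prod β) =
      ∫⁻ q, ENNReal.ofReal (|(q.1 : ℝ)| ^ (k + 1)) * f (ofPair q) ∂(pairMeas β) := by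
  have hm : Measurable fun q : ℝˣ × SLR (k + 1) => ENNReal.ofReal (|(q.1 : ℝ)| ^ (k + 1)) :=
    ((((comap_measurable _).comp measurable_fst).abs).pow_const _).ennreal_ofReal
  rw [lintegral_pairMeas β
    (f := fun q => ENNReal.ofReal (|(q.1 : ℝ)| ^ (k + 1)) * f (ofPair q))
    (hm.mul (hf.comp measurable_ofPair))]
  refine lintegral_congr_ae (h0.mono fun p hp => ?_)
  dsimp only
  have h1 : ((toPair p).1 : ℝ) = consDet p := by simp [toPair, hp]
  rw [h1, ofPair_toPair hp, ← mul_assoc, detWeight, ← ENNReal.ofReal_mul (by positivity),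
    inv_mul_cancel₀ (pow_ne_zero _ (abs_ne_zero.2 hp)), ENNReal.ofReal_one, one_mul]

theorem pairMeas_preimage (β : Measure (Fin k → Fin (k + 1) → ℝ))
    {B : Set ((Fin (k + 1) → ℝ) × (Fin k → Fin (k + 1) → ℝ))} (hB : MeasurableSet B) :
    pairMeas β (ofPair ⁻¹' B) = ∫⁻ p in B, detWeight p ∂(volume.prod β) := by
  unfold pairMeas
  rw [Measure.map_apply measurable_toPair (measurable_ofPair hB),
    withDensity_apply _ (measurable_toPair (measurable_ofPair hB)),
    ← lintegral_indicator (measurable_toPair (measurable_ofPair hB)),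
    ← lintegral_indicator hB]
  refine lintegral_congr fun p => ?_
  by_cases hp : consDet p = 0
  · have : detWeight p = 0 := by simp [detWeight, hp]
    simp [Set.indicator, this]
  · have : p ∈ toPair ⁻¹' (ofPair ⁻¹' B) ↔ p ∈ B := by
      rw [Set.mem_preimage, Set.mem_preimage, ofPair_toPair hp]
    by_cases h : p ∈ B
    · rw [Set.indicator_of_mem h, Set.indicator_of_mem (this.2 h)]
    · rw [Set.indicator_of_notMem h, Set.indicator_of_notMem (this.not.2 h)]

instance : SigmaFinite (pairMeas (k := k) volume) := by
  set B : ℕ → Set ((Fin (k + 1) → ℝ) × (Fin k → Fin (k + 1) → ℝ)) := fun j =>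
    {p | 1 / ((j : ℝ) + 1) < |consDet p|} ∩ Metric.ball 0 j with hB
  have hBm : ∀ j, MeasurableSet (B j) := fun j =>
    ((isOpen_lt continuous_const continuous_consDet.abs).inter Metric.isOpen_ball).measurableSet
  refine ⟨⟨⟨fun j => ofPair ⁻¹' B j, fun _ => trivial, fun j => ?_, ?_⟩⟩⟩
  · rw [pairMeas_preimage _ (hBm j)]
    have hv : (volume.prod volume : Measure ((Fin (k + 1) → ℝ) × (Fin k → Fin (k + 1) → ℝ))) (B j)
        ≠ ⊤ :=
      ((measure_mono Set.inter_subset_right).trans_lt Metric.isBounded_ball.measure_lt_top).ne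
    refine lt_of_le_of_lt ?_ (ENNReal.mul_ne_top
      (ENNReal.ofReal_ne_top (r := ((j : ℝ) + 1) ^ (k + 1))) hv).lt_top
    rw [← setLIntegral_const]
    refine setLIntegral_mono measurable_const fun p hp => ENNReal.ofReal_le_ofReal ?_
    have h3 : 1 / ((j : ℝ) + 1) < |consDet p| := hp.1
    have h4 : (0 : ℝ) < |consDet p| := lt_trans (by positivity) h3
    rw [← inv_pow]
    refine pow_le_pow_left₀ (by positivity) ?_ _
    rw [inv_le_comm₀ h4 (by positivity), ← one_div]
    exact h3.le
  · refine Set.eq_univ_of_forall fun q => ?_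
    have hq : 0 < |consDet (ofPair q)| := by
      rw [consDet_ofPair]
      exact abs_pos.2 q.1.ne_zero
    obtain ⟨j, hj⟩ := exists_nat_gt (max (1 / |consDet (ofPair q)|) ‖ofPair q‖)
    rw [max_lt_iff] at hj
    refine Set.mem_iUnion.2 ⟨j, ?_, ?_⟩
    · rw [Set.mem_ofPred_eq, one_div_lt (by positivity) hq]
      linarith [hj.1]
    · rw [mem_ball_zero_iff]
      exact hj.2

theorem exists_pairMeas_volume : ∃ s, MeasurableSet s ∧ pairMeas (k := k) volume s ≠ 0 ∧
    pairMeas (k := k) volume s ≠ ⊤ := by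
  set B : Set ((Fin (k + 1) → ℝ) × (Fin k → Fin (k + 1) → ℝ)) :=
    {p | 1 / 2 < consDet p} ∩ Metric.ball 0 2 with hB
  have hBo : IsOpen B := (isOpen_lt continuous_const continuous_consDet).inter Metric.isOpen_ball
  have hBm := hBo.measurableSet
  have hne : B.Nonempty := by
    refine ⟨ofPair 1, ?_, ?_⟩
    · simp only [Set.mem_ofPred_eq, consDet_ofPair]
      norm_num
    · rw [mem_ball_zero_iff, Prod.norm_def, max_lt_iff]
      have hr : ∀ i j, |rows (1 : SLR (k + 1)) i j| ≤ 1 := by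
        intro i j
        by_cases h : i = j <;> simp [rows, h]
      constructor
      · refine (pi_norm_lt_iff two_pos).2 fun j => ?_
        simpa [ofPair] using (hr 0 j).trans_lt one_lt_two
      · refine (pi_norm_lt_iff two_pos).2 fun i => (pi_norm_lt_iff two_pos).2 fun j => ?_
        simpa [ofPair] using (hr i.succ j).trans_lt one_lt_two
  have hvol0 : (volume.prod volume : Measure ((Fin (k + 1) → ℝ) × (Fin k → Fin (k + 1) → ℝ))) B
      ≠ 0 := (hBo.measure_pos _ hne).ne'
  have hvolt : (volume.prod volume : Measure ((Fin (k + 1) → ℝ) × (Fin k → Fin (k + 1) → ℝ))) B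
      ≠ ⊤ :=
    ((measure_mono Set.inter_subset_right).trans_lt Metric.isBounded_ball.measure_lt_top).ne
  refine ⟨ofPair ⁻¹' B, measurable_ofPair hBm, ?_, ?_⟩ <;> rw [pairMeas_preimage _ hBm]
  · intro h
    rw [lintegral_eq_zero_iff measurable_detWeight] at h
    refine hvol0 ?_
    have h2 : ∀ᵐ p ∂((volume.prod volume).restrict B), False := by
      filter_upwards [h, ae_restrict_mem hBm] with p hp hpB
      have h3 : (0 : ℝ) < consDet p := lt_trans (by norm_num) hpB.1
      simp only [detWeight, Pi.zero_apply, ENNReal.ofReal_eq_zero] at hp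
      exact absurd hp (not_le.2 (by positivity))
    simpa using h2
  · refine ne_top_of_le_ne_top (ENNReal.mul_ne_top (ENNReal.ofReal_ne_top (r := 2 ^ (k + 1)))
      hvolt) ?_
    rw [← setLIntegral_const]
    refine setLIntegral_mono measurable_const fun p hp => ENNReal.ofReal_le_ofReal ?_
    have h3 : (1 / 2 : ℝ) < consDet p := hp.1
    rw [← inv_pow]
    refine pow_le_pow_left₀ (by positivity) ?_ _
    rw [inv_le_comm₀ (by positivity) two_pos, abs_of_pos (lt_trans (by norm_num) h3)]
    linarith

/-- Uniqueness of left invariant measures, where one of them is only assumed s-finite. -/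
theorem measure_mul_measure_eq_of_sFinite {G : Type*} [MeasurableSpace G] [Group G]
    [MeasurableMul₂ G] [MeasurableInv G] (μ ν : Measure G) [SFinite μ] [SigmaFinite ν]
    [μ.IsMulLeftInvariant] [ν.IsMulLeftInvariant] {s t : Set G} (hs : MeasurableSet s)
    (ht : MeasurableSet t) (h2s : ν s ≠ 0) (h3s : ν s ≠ ⊤) : μ s * ν t = ν s * μ t := by
  have key : ∀ (m : Measure G) [SFinite m] [m.IsMulLeftInvariant],
      m s * ∫⁻ y, t.indicator (fun _ => 1) y⁻¹ / ν ((· * y⁻¹) ⁻¹' s) ∂ν = m t := by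
    intro m _ _
    have hf : Measurable (t.indicator fun _ => (1 : ENNReal)) := measurable_const.indicator ht
    set g := fun y => t.indicator (fun _ => (1 : ENNReal)) y⁻¹ / ν ((fun x => x * y⁻¹) ⁻¹' s)
    have hg : Measurable g :=
      (hf.comp measurable_inv).div ((measurable_measure_mul_right ν hs).comp measurable_inv)
    rw [measure_mul_lintegral_eq m ν hs g hg]
    simp_rw [g, inv_inv]
    rw [← lintegral_indicator_one ht]
    have hν : ν ≠ 0 := by
      rintro rfl
      exact h2s rfl
    have h := (ae_measure_preimage_mul_right_lt_top ν ν h3s).filter_mono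
      (absolutelyContinuous_of_isMulLeftInvariant m ν hν).ae_le
    refine lintegral_congr_ae (h.mono fun x hx => ?_)
    dsimp only
    rw [ENNReal.mul_div_cancel (measure_mul_right_ne_zero ν h2s _) hx.ne]
    rfl
  rw [← key ν, ← key μ, mul_left_comm]

/-- Uniqueness of invariant measures on tuples of `k` row vectors in dimension `k + 1`. -/
theorem eq_smul_volume_of_map_act {β : Measure (Fin k → Fin (k + 1) → ℝ)} [SFinite β]
    (hβ : ∀ h, β.map (fun y => act y h) = β) (h0 : ∀ᵐ p ∂(volume.prod β), consDet p ≠ 0)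
    (h0' : ∀ᵐ p ∂(volume.prod (volume : Measure (Fin k → Fin (k + 1) → ℝ))), consDet p ≠ 0) :
    ∃ c : ENNReal, β = c • volume := by
  obtain ⟨s, hsm, hs0, hst⟩ := exists_pairMeas_volume (k := k)
  have i1 := isMulLeftInvariant_pairMeas hβ
  have i2 := isMulLeftInvariant_pairMeas (k := k) (β := volume)
    fun h => (measurePreserving_act h).map_eq
  set c := pairMeas β s / pairMeas (k := k) volume s with hc
  have hρ : pairMeas β = c • pairMeas volume := by
    ext t ht
    have := measure_mul_measure_eq_of_sFinite (pairMeas β) (pairMeas (k := k) volume) hsm ht hs0 hst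
    rw [Measure.smul_apply, smul_eq_mul, hc, ENNReal.div_eq_inv_mul, mul_assoc, this, ← mul_assoc,
      ENNReal.inv_mul_cancel hs0 hst, one_mul]
  have hprod : (volume : Measure (Fin (k + 1) → ℝ)).prod β = c • volume.prod volume := by
    refine Measure.ext_of_lintegral _ fun f hf => ?_
    rw [lintegral_smul_measure, lintegral_prod_eq_pairMeas β h0 hf,
      lintegral_prod_eq_pairMeas _ h0' hf, hρ, lintegral_smul_measure]
  refine ⟨c, ?_⟩
  ext S hS
  have h := congrArg (fun m => m (Set.Icc (0 : Fin (k + 1) → ℝ) 1 ×ˢ S)) hprod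
  have hv : (volume : Measure (Fin (k + 1) → ℝ)) (Set.Icc 0 1) = 1 := by
    rw [Real.volume_Icc_pi]
    simp
  simpa only [Measure.smul_apply, Measure.prod_prod, hv, one_mul] using h

end

section

variable {k n : ℕ}

/-- An invariant measure on tuples that is concentrated on linearly independent tuples. -/
structure IndepInvariant (β : Measure (Fin k → Fin n → ℝ)) : Prop where
  map_act : ∀ h, β.map (fun y => act y h) = β
  ae_indep : ∀ᵐ y ∂β, LinearIndependent ℝ y

/-- The measure obtained by adding a Lebesgue distributed first vector. -/
def padMeas (β : Measure (Fin k → Fin n → ℝ)) : Measure (Fin (k + 1) → Fin n → ℝ) :=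
  (volume.prod β).map fun p => Fin.cons p.1 p.2

theorem measurable_finCons : Measurable fun p : (Fin n → ℝ) × (Fin k → Fin n → ℝ) =>
    (Fin.cons p.1 p.2 : Fin (k + 1) → Fin n → ℝ) :=
  continuous_finCons.measurable

instance (β : Measure (Fin k → Fin n → ℝ)) [SFinite β] : SFinite (padMeas β) := by
  unfold padMeas
  infer_instance

theorem padMeas_volume : padMeas (volume : Measure (Fin k → Fin n → ℝ)) = volume := by
  have h := (volume_preserving_piFinSuccAbove (fun _ : Fin (k + 1) => Fin n → ℝ) 0).symm.map_eq
  rw [← h]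
  unfold padMeas
  congr 1
  funext p
  simp [MeasurableEquiv.piFinSuccAbove, Fin.insertNthEquiv, Fin.insertNth_zero']

theorem measurableSet_linearIndependent :
    MeasurableSet {y : Fin k → Fin n → ℝ | LinearIndependent ℝ y} :=
  (isOpen_setOfPred_linearIndependent).measurableSet

theorem IndepInvariant.padMeas {β : Measure (Fin k → Fin n → ℝ)} [SFinite β] (hk : k < n)
    (h : IndepInvariant β) : IndepInvariant (padMeas β) := by
  refine ⟨fun g => ?_, ?_⟩
  · unfold SLR.padMeas
    rw [Measure.map_map (measurable_act_right g) measurable_finCons]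
    have e : (fun y => act y g) ∘ (fun p : (Fin n → ℝ) × (Fin k → Fin n → ℝ) =>
        (Fin.cons p.1 p.2 : Fin (k + 1) → Fin n → ℝ)) =
        (fun p => Fin.cons p.1 p.2) ∘ Prod.map (fun z => vact z g) (fun y => act y g) := by
      funext p i
      refine Fin.cases ?_ (fun i => ?_) i <;> rfl
    rw [e, ← Measure.map_map measurable_finCons
      ((measurable_vact g).prodMap (measurable_act_right g)),
      ← Measure.map_prod_map _ _ (measurable_vact g) (measurable_act_right g),
      (measurePreserving_vact g).map_eq, h.map_act]
  · unfold SLR.padMeas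
    rw [ae_map_iff measurable_finCons.aemeasurable measurableSet_linearIndependent]
    have hm : MeasurableSet {p : (Fin n → ℝ) × (Fin k → Fin n → ℝ) |
        LinearIndependent ℝ (Fin.cons p.1 p.2 : Fin (k + 1) → Fin n → ℝ)} :=
      measurable_finCons measurableSet_linearIndependent
    rw [← Measure.prod_swap, ae_map_iff measurable_swap.aemeasurable hm]
    refine (Measure.ae_prod_iff_ae_ae (measurable_swap hm)).2 ?_
    filter_upwards [h.ae_indep] with y hy
    have hW : Submodule.span ℝ (Set.range y) ≠ ⊤ := by
      intro ht
      have h1 := finrank_range_le_card (R := ℝ) y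
      rw [Set.finrank, ht, finrank_top] at h1
      simp at h1
      omega
    have h0 := Measure.addHaar_submodule (volume : Measure (Fin n → ℝ)) _ hW
    filter_upwards [measure_eq_zero_iff_ae_notMem.1 h0] with z hz
    exact linearIndependent_finCons.2 ⟨hy, hz⟩

theorem indepInvariant_volume (hk : k ≤ n) :
    IndepInvariant (volume : Measure (Fin k → Fin n → ℝ)) := by
  induction k with
  | zero => exact ⟨fun g => (measurePreserving_act g).map_eq,
      Filter.Eventually.of_forall fun y => linearIndependent_empty_type⟩
  | succ k ih =>
    rw [← padMeas_volume]
    exact (ih (by omega)).padMeas (by omega)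

theorem consDet_ne_zero_iff (p : (Fin (k + 1) → ℝ) × (Fin k → Fin (k + 1) → ℝ)) :
    consDet p ≠ 0 ↔ LinearIndependent ℝ (Fin.cons p.1 p.2 : Fin (k + 1) → Fin (k + 1) → ℝ) := by
  rw [← isUnit_iff_ne_zero, consDet, ← Matrix.isUnit_iff_isUnit_det,
    ← Matrix.linearIndependent_rows_iff_isUnit]
  rfl

/-- Invariant measures on independent tuples are multiples of the Lebesgue measure. -/
theorem IndepInvariant.exists_eq_smul_volume {β : Measure (Fin k → Fin n → ℝ)} [SFinite β]
    (hk : k < n) (h : IndepInvariant β) : ∃ c : ENNReal, β = c • volume := by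
  obtain ⟨d, hd⟩ : ∃ d, n = k + 1 + d := ⟨n - (k + 1), by omega⟩
  induction d generalizing k with
  | zero =>
    subst hd
    refine eq_smul_volume_of_map_act h.map_act ?_ ?_
    · have := (h.padMeas hk).ae_indep
      simp_rw [consDet_ne_zero_iff]
      exact ae_of_ae_map measurable_finCons.aemeasurable this
    · have := ((indepInvariant_volume hk.le).padMeas hk).ae_indep
      simp_rw [consDet_ne_zero_iff]
      exact ae_of_ae_map measurable_finCons.aemeasurable this
  | succ d ih =>
    obtain ⟨c, hc⟩ := ih (by omega) (h.padMeas hk) (by omega)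
    refine ⟨c, ?_⟩
    ext S hS
    have hT : MeasurableSet {y : Fin (k + 1) → Fin n → ℝ |
        y 0 ∈ Set.Icc (0 : Fin n → ℝ) 1 ∧ Fin.tail y ∈ S} :=
      (measurable_pi_apply 0 measurableSet_Icc).inter
        ((measurable_pi_lambda _ fun i => measurable_pi_apply i.succ) hS)
    rw [← padMeas_volume] at hc
    have h1 := congrArg (fun m => m {y : Fin (k + 1) → Fin n → ℝ |
        y 0 ∈ Set.Icc (0 : Fin n → ℝ) 1 ∧ Fin.tail y ∈ S}) hc
    have hpre : (fun p : (Fin n → ℝ) × (Fin k → Fin n → ℝ) =>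
        (Fin.cons p.1 p.2 : Fin (k + 1) → Fin n → ℝ)) ⁻¹' {y : Fin (k + 1) → Fin n → ℝ |
        y 0 ∈ Set.Icc (0 : Fin n → ℝ) 1 ∧ Fin.tail y ∈ S} = Set.Icc (0 : Fin n → ℝ) 1 ×ˢ S := by
      ext p
      simp
    have hv : (volume : Measure (Fin n → ℝ)) (Set.Icc 0 1) = 1 := by
      rw [Real.volume_Icc_pi]
      simp
    simpa only [SLR.padMeas, Measure.smul_apply, Measure.map_apply measurable_finCons hT, hpre,
      Measure.prod_prod, hv, one_mul] using h1

end

section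

variable {k n : ℕ} {μ : Measure (SLR n)} [μ.IsHaarMeasure] {F : Set (SLR n)}

/-- A set of integer tuples that are linearly independent over the reals. -/
def IndepTup (I : Set (Fin k → Fin n → ℤ)) : Prop := ∀ v ∈ I, LinearIndependent ℝ (intTup v)

theorem linearIndependent_act {y : Fin k → Fin n → ℝ} (h : LinearIndependent ℝ y) (g : SLR n) :
    LinearIndependent ℝ (act y g) := by
  have hg : Function.Injective (Matrix.vecMulLinear (g : Matrix (Fin n) (Fin n) ℝ)) := by
    refine Matrix.vecMul_injective_of_isUnit ?_
    rw [Matrix.isUnit_iff_isUnit_det, g.2]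
    exact isUnit_one
  have := h.map' _ (LinearMap.ker_eq_bot.2 hg)
  exact this

theorem indepInvariant_tupMeas (hF : IsFundamentalDomain (Gam n) F μ) (h1 : μ F = 1)
    {I : Set (Fin k → Fin n → ℤ)} (hI : InvTup I) (hI' : IndepTup I) :
    IndepInvariant (tupMeas μ F I) := by
  refine ⟨map_act_tupMeas hF h1 hI, ?_⟩
  unfold tupMeas
  rw [Measure.ae_sum_iff' measurableSet_linearIndependent]
  intro v
  rw [ae_map_iff (measurable_act_left _).aemeasurable measurableSet_linearIndependent]
  exact Filter.Eventually.of_forall fun g => linearIndependent_act (hI' _ v.2) g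

/-- The proportionality constant in the mean value formula for a set of integer tuples. -/
def siegelConst (μ : Measure (SLR n)) (F : Set (SLR n)) (I : Set (Fin k → Fin n → ℤ)) : ENNReal :=
  tupMeas μ F I (Set.Icc 0 1)

theorem volume_Icc_tuples : (volume : Measure (Fin k → Fin n → ℝ)) (Set.Icc 0 1) = 1 := by
  have : Set.Icc (0 : Fin k → Fin n → ℝ) 1 = Set.univ.pi fun _ => Set.univ.pi fun _ =>
      Set.Icc (0 : ℝ) 1 := by
    ext y
    simp only [Set.mem_Icc, Set.mem_univ_pi, Pi.le_def, Pi.zero_apply, Pi.one_apply]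
    exact ⟨fun h i j => ⟨h.1 i j, h.2 i j⟩, fun h => ⟨fun i j => (h i j).1, fun i j => (h i j).2⟩⟩
  rw [this]
  refine (volume_pi_pi _).trans (Finset.prod_eq_one fun i _ => ?_)
  rw [volume_pi_pi]
  simp

theorem tupMeas_eq (hF : IsFundamentalDomain (Gam n) F μ) (h1 : μ F = 1) (hk : k < n)
    {I : Set (Fin k → Fin n → ℤ)} (hI : InvTup I) (hI' : IndepTup I) :
    tupMeas μ F I = siegelConst μ F I • volume := by
  obtain ⟨c, hc⟩ := (indepInvariant_tupMeas hF h1 hI hI').exists_eq_smul_volume hk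
  rw [siegelConst, hc, Measure.smul_apply, volume_Icc_tuples, smul_eq_mul, mul_one]

/-- The mean value formula for a set of linearly independent integer tuples. -/
theorem lintegral_tsum_act (hF : IsFundamentalDomain (Gam n) F μ) (h1 : μ F = 1) (hk : k < n)
    {I : Set (Fin k → Fin n → ℤ)} (hI : InvTup I) (hI' : IndepTup I)
    {f : (Fin k → Fin n → ℝ) → ENNReal} (hf : Measurable f) :
    ∫⁻ g in F, ∑' v : I, f (act (intTup v.1) g) ∂μ = siegelConst μ F I * ∫⁻ y, f y := by
  rw [← lintegral_tupMeas I hf, tupMeas_eq hF h1 hk hI hI', lintegral_smul_measure, smul_eq_mul]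

end

section

variable {n : ℕ}

/-- Two integer vectors are related if some element of `SL_n(ℤ)` fixing the first `j` standard
basis vectors maps one to the other. -/
def ColRel (j : ℕ) (w w' : Fin n → ℤ) : Prop :=
  ∃ γ : Matrix.SpecialLinearGroup (Fin n) ℤ,
    (∀ i : Fin n, (i : ℕ) < j → Pi.single i 1 ᵥ* γ.1 = Pi.single i 1) ∧ w ᵥ* γ.1 = w'

theorem ColRel.refl (j : ℕ) (w : Fin n → ℤ) : ColRel j w w := ⟨1, by simp, by simp⟩

theorem ColRel.trans {j : ℕ} {u v w : Fin n → ℤ} (h : ColRel j u v) (h' : ColRel j v w) :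
    ColRel j u w := by
  obtain ⟨γ, h1, h2⟩ := h
  obtain ⟨δ, h3, h4⟩ := h'
  refine ⟨γ * δ, fun i hi => ?_, ?_⟩
  · rw [Matrix.SpecialLinearGroup.coe_mul, ← Matrix.vecMul_vecMul, h1 i hi, h3 i hi]
  · rw [Matrix.SpecialLinearGroup.coe_mul, ← Matrix.vecMul_vecMul, h2, h4]

theorem colRel_update {j : ℕ} (w : Fin n → ℤ) {a b : Fin n} (ha : j ≤ a) (hab : a ≠ b) (c : ℤ) :
    ColRel j w (Function.update w b (w b + c * w a)) := by
  have hvec : ∀ u : Fin n → ℤ, u ᵥ* Matrix.transvection a b c =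
      Function.update u b (u b + c * u a) := by
    intro u
    rw [Matrix.transvection, Matrix.vecMul_add, Matrix.vecMul_one]
    funext i
    by_cases h : i = b
    · subst h
      simp [Matrix.vecMul, dotProduct, Matrix.single_apply, mul_comm]
    · simp [Matrix.vecMul, dotProduct, h, Ne.symm h]
  refine ⟨⟨Matrix.transvection a b c, Matrix.det_transvection_of_ne a b hab c⟩, fun i hi => ?_,
    hvec w⟩
  rw [hvec]
  have : i ≠ a := by
    rintro rfl
    omega
  rw [Pi.single_eq_of_ne this.symm]
  simp

theorem exists_colRel_single {j : ℕ} (w : Fin n → ℤ) (hw : ∃ l : Fin n, j ≤ l ∧ w l ≠ 0) :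
    ∃ w', ColRel j w w' ∧ ∃ p : Fin n, j ≤ p ∧ w' p ≠ 0 ∧
      ∀ l : Fin n, j ≤ l → l ≠ p → w' l = 0 := by
  induction hN : ∑ l : Fin n, (if j ≤ (l : ℕ) then (w l).natAbs else 0) using
    Nat.strong_induction_on generalizing w with
  | _ N ih =>
  by_cases h : ∃ a b : Fin n, j ≤ a ∧ j ≤ b ∧ a ≠ b ∧ w a ≠ 0 ∧ w b ≠ 0 ∧
      (w a).natAbs ≤ (w b).natAbs
  · obtain ⟨a, b, ha, hb, hab, hwa, hwb, hle⟩ := h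
    set w1 := Function.update w b (w b + -(w b / w a) * w a) with hw1
    have hr := colRel_update w ha hab (-(w b / w a))
    have hw1b : w1 b = w b % w a := by
      rw [hw1, Function.update_self, Int.emod_def]
      ring
    have hw1a : w1 a = w a := by rw [hw1, Function.update_of_ne hab]
    have hlt : (w1 b).natAbs < (w b).natAbs := by
      rw [hw1b]
      have h1 := Int.emod_nonneg (w b) hwa
      have h2 := Int.emod_lt_abs (w b) hwa
      zify at hle ⊢
      rw [abs_of_nonneg h1]
      exact h2.trans_le hle
    have hlt' : ∑ l : Fin n, (if j ≤ (l : ℕ) then (w1 l).natAbs else 0) < N := by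
      rw [← hN]
      refine Finset.sum_lt_sum (fun l _ => ?_) ⟨b, Finset.mem_univ _, by simpa [hb] using hlt⟩
      by_cases hl : l = b
      · subst hl
        simpa [hb] using hlt.le
      · rw [hw1, Function.update_of_ne hl]
    obtain ⟨w', h1, h2⟩ := ih _ hlt' w1 ⟨a, ha, by rwa [hw1a]⟩ rfl
    exact ⟨w', hr.trans h1, h2⟩
  · obtain ⟨p, hp, hwp⟩ := hw
    refine ⟨w, ColRel.refl _ _, p, hp, hwp, fun l hl hlp => ?_⟩
    by_contra h0
    rcases le_total (w p).natAbs (w l).natAbs with h3 | h3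
    · exact h ⟨p, l, hp, hl, hlp.symm, hwp, h0, h3⟩
    · exact h ⟨l, p, hl, hp, hlp, h0, hwp, h3⟩

theorem exists_colRel_zero_of_lt {j : ℕ} (hj : j < n) (w : Fin n → ℤ)
    (hw : ∃ l : Fin n, j ≤ l ∧ w l ≠ 0) :
    ∃ w', ColRel j w w' ∧ w' ⟨j, hj⟩ ≠ 0 ∧ ∀ l : Fin n, j < l → w' l = 0 := by
  obtain ⟨w1, h1, p, hp, hwp, h0⟩ := exists_colRel_single w hw
  by_cases hpj : p = ⟨j, hj⟩
  · subst hpj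
    refine ⟨w1, h1, hwp, fun l hl => h0 l hl.le ?_⟩
    rintro rfl
    simp at hl
  · set q : Fin n := ⟨j, hj⟩ with hq
    have r1 := colRel_update w1 hp hpj 1
    set w2 := Function.update w1 q (w1 q + 1 * w1 p) with hw2
    have r2 := colRel_update w2 (a := q) (b := p) le_rfl (Ne.symm hpj) (-1)
    have e0 : w1 q = 0 := h0 q le_rfl (Ne.symm hpj)
    have e1 : w2 q = w1 p := by simp [hw2, e0]
    have e2 : w2 p = w1 p := by simp [hw2, hpj]
    refine ⟨_, (h1.trans r1).trans r2, ?_, fun l hl => ?_⟩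
    · rw [Function.update_of_ne (Ne.symm hpj), e1]
      exact hwp
    · by_cases hlp : l = p
      · subst hlp
        rw [Function.update_self, e1, e2]
        ring
      · have hlq : l ≠ q := by
          rintro rfl
          simp [hq] at hl
        rw [Function.update_of_ne hlp, hw2, Function.update_of_ne hlq]
        exact h0 l hl.le hlp

/-- Hermite normal form of a single vector. -/
theorem exists_colRel_reduced {j : ℕ} (hj : j < n) (w : Fin n → ℤ)
    (hw : ∃ l : Fin n, j ≤ l ∧ w l ≠ 0) :
    ∃ w', ColRel j w w' ∧ w' ⟨j, hj⟩ ≠ 0 ∧ (∀ l : Fin n, j < l → w' l = 0) ∧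
      ∀ l : Fin n, (l : ℕ) < j → 0 ≤ w' l ∧ w' l < |w' ⟨j, hj⟩| := by
  obtain ⟨w1, h1, hd, h0⟩ := exists_colRel_zero_of_lt hj w hw
  have key : ∀ s : Finset (Fin n), (∀ l ∈ s, (l : ℕ) < j) → ∃ w', ColRel j w1 w' ∧
      w' ⟨j, hj⟩ = w1 ⟨j, hj⟩ ∧ (∀ l : Fin n, j < l → w' l = 0) ∧
      ∀ l ∈ s, 0 ≤ w' l ∧ w' l < |w' ⟨j, hj⟩| := by
    intro s
    induction s using Finset.induction_on with
    | empty => exact fun _ => ⟨w1, ColRel.refl _ _, rfl, h0, by simp⟩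
    | insert b s hb ih =>
      intro hs
      obtain ⟨w2, r, e, z, hr⟩ := ih fun l hl => hs l (Finset.mem_insert_of_mem hl)
      have hbj := hs b (Finset.mem_insert_self _ _)
      have hne : (⟨j, hj⟩ : Fin n) ≠ b := by
        rintro rfl
        simp at hbj
      have r2 := colRel_update w2 (a := ⟨j, hj⟩) (b := b) le_rfl hne (-(w2 b / w2 ⟨j, hj⟩))
      refine ⟨_, r.trans r2, ?_, fun l hl => ?_, fun l hl => ?_⟩
      · rw [Function.update_of_ne hne, e]
      · rw [Function.update_of_ne, z l hl]
        rintro rfl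
        omega
      · rw [Function.update_of_ne hne]
        by_cases hlb : l = b
        · subst hlb
          rw [Function.update_self]
          have : w2 l + -(w2 l / w2 ⟨j, hj⟩) * w2 ⟨j, hj⟩ = w2 l % w2 ⟨j, hj⟩ := by
            rw [Int.emod_def]
            ring
          rw [this]
          exact ⟨Int.emod_nonneg _ (by rwa [e]), Int.emod_lt_abs _ (by rwa [e])⟩
        · rw [Function.update_of_ne hlb]
          exact hr l ((Finset.mem_insert.1 hl).resolve_left hlb)
  obtain ⟨w', r, e, z, hr⟩ := key (Finset.univ.filter fun l => (l : ℕ) < j) (by simp)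
  exact ⟨w', h1.trans r, by rwa [e], z, fun l hl => hr l (by simpa using hl)⟩

end

section

variable {k n : ℕ} {μ : Measure (SLR n)} [μ.IsHaarMeasure] {F : Set (SLR n)}

theorem lintegral_smul_add {h : (Fin n → ℝ) → ENNReal} (hh : Measurable h) {d : ℝ} (hd : d ≠ 0)
    (c : Fin n → ℝ) :
    ∫⁻ z, h (d • z + c) = ENNReal.ofReal (|d| ^ n)⁻¹ * ∫⁻ z, h z := by
  have h1 := Measure.map_addHaar_smul (volume : Measure (Fin n → ℝ)) hd
  have h2 := lintegral_map (μ := (volume : Measure (Fin n → ℝ))) (f := fun z => h (z + c))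
    (g := fun z => d • z) (by fun_prop) (by fun_prop)
  rw [← h2, h1, lintegral_smul_measure, lintegral_add_right_eq_self h c, smul_eq_mul,
    Module.finrank_fin_fun, abs_inv, abs_pow]

theorem lintegral_update {m : ℕ} (j : Fin (m + 1)) {d : ℝ} (hd : d ≠ 0)
    {φ : (Fin (m + 1) → Fin n → ℝ) → Fin n → ℝ} (hφ : Measurable φ)
    (hφ' : ∀ y z, φ (Function.update y j z) = φ y)
    {f : (Fin (m + 1) → Fin n → ℝ) → ENNReal} (hf : Measurable f) :
    ∫⁻ y, f (Function.update y j (d • y j + φ y)) = ENNReal.ofReal (|d| ^ n)⁻¹ * ∫⁻ y, f y := by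
  have hup : Measurable fun y : Fin (m + 1) → Fin n → ℝ =>
      Function.update y j (d • y j + φ y) := by
    refine measurable_pi_lambda _ fun i => ?_
    by_cases h : i = j
    · subst h
      simp only [Function.update_self]
      exact ((measurable_pi_apply _).const_smul d).add hφ
    · simp only [Function.update_of_ne h]
      exact measurable_pi_apply i
  have key : ∀ g : (Fin (m + 1) → Fin n → ℝ) → ENNReal, Measurable g →
      ∫⁻ y, g y = ∫⁻ r : Fin m → Fin n → ℝ, ∫⁻ z : Fin n → ℝ, g (j.insertNth z r) := by
    intro g hg
    have hp := (volume_preserving_piFinSuccAbove (fun _ : Fin (m + 1) => Fin n → ℝ) j).symm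
    rw [← hp.map_eq, lintegral_map hg hp.measurable]
    exact lintegral_prod_symm' _ (hg.comp hp.measurable)
  have hins : Measurable fun p : (Fin n → ℝ) × (Fin m → Fin n → ℝ) =>
      (j.insertNth p.1 p.2 : Fin (m + 1) → Fin n → ℝ) :=
    (MeasurableEquiv.piFinSuccAbove (fun _ : Fin (m + 1) => Fin n → ℝ) j).symm.measurable
  rw [key (fun y => f (Function.update y j (d • y j + φ y))) (hf.comp hup), key f hf,
    ← lintegral_const_mul]
  · refine lintegral_congr fun r => ?_
    rw [← lintegral_smul_add (h := fun z => f (j.insertNth z r)) (hf.comp (hins.comp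
      (measurable_id.prodMk measurable_const))) hd (φ (j.insertNth 0 r))]
    refine lintegral_congr fun z => ?_
    have e : φ (j.insertNth z r) = φ (j.insertNth 0 r) := by
      rw [← hφ' _ 0, Fin.update_insertNth]
    rw [Fin.update_insertNth, Fin.insertNth_apply_same, e]
  · exact (hf.comp hins).lintegral_prod_left'

/-- Independent integer `k`-tuples in dimension `k + 1` whose first `j` vectors are the first `j`
rows of an element of `SL(ℤ)`. -/
def frameTup (k j : ℕ) : Set (Fin k → Fin (k + 1) → ℤ) :=
  {v | LinearIndependent ℝ (intTup v) ∧ ∃ γ : Matrix.SpecialLinearGroup (Fin (k + 1)) ℤ,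
    ∀ i : Fin k, (i : ℕ) < j → v i = Pi.single i.castSucc 1 ᵥ* γ.1}

theorem invTup_linearIndependent :
    InvTup {v : Fin k → Fin n → ℤ | LinearIndependent ℝ (intTup v)} := by
  intro γ v hv
  rw [Set.mem_ofPred_eq, ← act_intTup]
  exact linearIndependent_act hv _

theorem invTup_frameTup (j : ℕ) : InvTup (frameTup k j) := by
  rintro γ v ⟨hv, δ, hδ⟩
  refine ⟨invTup_linearIndependent γ v hv, δ * γ, fun i hi => ?_⟩
  dsimp only
  rw [hδ i hi, Matrix.SpecialLinearGroup.coe_mul, Matrix.vecMul_vecMul]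

theorem indepTup_frameTup (j : ℕ) : IndepTup (frameTup k j) := fun _ hv => hv.1

theorem linearIndependent_int {v : Fin k → Fin n → ℤ} (h : LinearIndependent ℝ (intTup v)) :
    LinearIndependent ℤ v := by
  rw [Fintype.linearIndependent_iff] at h ⊢
  intro c hc i
  have h1 : ∑ i, (c i : ℝ) • intTup v i = 0 := by
    funext l
    have := congrFun hc l
    simp only [Finset.sum_apply, Pi.smul_apply, smul_eq_mul, Pi.zero_apply, intTup,
      intVec] at this ⊢
    exact_mod_cast this
  exact_mod_cast h (fun i => (c i : ℝ)) h1 i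

theorem linearIndependent_of_mem_span {V : Type*} [AddCommGroup V] [Module ℝ V]
    {v v' : Fin k → V} (h : LinearIndependent ℝ v)
    (hs : ∀ i, v i ∈ Submodule.span ℝ (Set.range v')) : LinearIndependent ℝ v' := by
  rw [linearIndependent_iff_card_le_finrank_span] at h ⊢
  refine h.trans ?_
  have : FiniteDimensional ℝ (Submodule.span ℝ (Set.range v')) :=
    FiniteDimensional.span_of_finite ℝ (Set.finite_range v')
  exact Submodule.finrank_mono (Submodule.span_le.2 (Set.range_subset_iff.2 hs))

theorem vecMul_eq_sum_castSucc {w : Fin (k + 1) → ℤ} (hw : w (Fin.last k) = 0)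
    (A : Matrix (Fin (k + 1)) (Fin (k + 1)) ℤ) :
    w ᵥ* A = ∑ i : Fin k, w i.castSucc • (Pi.single i.castSucc 1 ᵥ* A) := by
  rw [Matrix.vecMul_eq_sum, Fin.sum_univ_castSucc, hw, zero_smul, add_zero]
  refine Finset.sum_congr rfl fun i _ => ?_
  rw [Matrix.single_one_vecMul]
  rfl

/-- The coefficients of a reduced integer vector. -/
def redCoef {j d : ℕ} (a : Fin j → Fin d) (i : Fin k) : ℤ :=
  if h : (i : ℕ) < j then ((a ⟨i, h⟩ : ℕ) : ℤ) else 0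

theorem exists_frameTup_succ (j : Fin k) {v : Fin k → Fin (k + 1) → ℤ} (hv : v ∈ frameTup k j) :
    ∃ d : ℤ, d ≠ 0 ∧ ∃ a : Fin (j : ℕ) → Fin d.natAbs, ∃ v' ∈ frameTup k (j + 1),
      v = Function.update v' j (d • v' j + ∑ i, (if i = j then 0 else redCoef a i) • v' i) := by
  obtain ⟨hLI, γ, hγ⟩ := hv
  set w := v j ᵥ* (γ⁻¹).1 with hw
  have hwγ : w ᵥ* γ.1 = v j := by
    rw [hw, Matrix.vecMul_vecMul, ← Matrix.SpecialLinearGroup.coe_mul, inv_mul_cancel]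
    simp
  have hne : ∃ l : Fin (k + 1), (j : ℕ) ≤ l ∧ w l ≠ 0 := by
    by_contra! hcon
    have hj := hcon j.castSucc (by simp)
    rw [vecMul_eq_sum_castSucc (hcon (Fin.last k) (by simp [j.2.le]))] at hwγ
    have h2 := Fintype.linearIndependent_iff.1 (linearIndependent_int hLI)
      (fun i => (if i = j then 1 else 0) - w i.castSucc) (by
        simp_rw [sub_smul, Finset.sum_sub_distrib, ite_smul, one_smul, zero_smul]
        rw [Finset.sum_ite_eq' Finset.univ j, if_pos (Finset.mem_univ _), sub_eq_zero]
        refine hwγ.symm.trans (Finset.sum_congr rfl fun i _ => ?_)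
        by_cases hi : (i : ℕ) < j
        · rw [hγ i hi]
        · rw [hcon i.castSucc (by simpa using hi), zero_smul, zero_smul]) j
    simp [hj] at h2
  obtain ⟨w', ⟨δ, hδ, hδw⟩, hd, h0, hr⟩ :=
    exists_colRel_reduced (j := j) (j.2.trans (Nat.lt_succ_self k)) w hne
  set d := w' ⟨j, j.2.trans (Nat.lt_succ_self k)⟩ with hd'
  have hdj : w' j.castSucc = d := rfl
  set η := δ⁻¹ * γ with hη
  have hvj : v j = w' ᵥ* η.1 := by
    rw [hη, ← hδw, Matrix.vecMul_vecMul, ← Matrix.SpecialLinearGroup.coe_mul, mul_inv_cancel_left,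
      hwγ]
  have hrow : ∀ i : Fin k, (i : ℕ) < j → v i = Pi.single i.castSucc 1 ᵥ* η.1 := by
    intro i hi
    rw [hγ i hi]
    conv_rhs => rw [← hδ i.castSucc (by simpa using hi)]
    rw [hη, Matrix.vecMul_vecMul, ← Matrix.SpecialLinearGroup.coe_mul, mul_inv_cancel_left]
  rw [vecMul_eq_sum_castSucc (h0 (Fin.last k) (by simp))] at hvj
  set v' := Function.update v j (Pi.single j.castSucc 1 ᵥ* η.1) with hv'
  have hv'ne : ∀ i, i ≠ j → v' i = v i := fun i hi => Function.update_of_ne hi _ _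
  have hv'j : v' j = Pi.single j.castSucc 1 ᵥ* η.1 := Function.update_self _ _ _
  set a : Fin (j : ℕ) → Fin d.natAbs := fun i => ⟨(w' ⟨i,
    i.2.trans (j.2.trans (Nat.lt_succ_self k))⟩).toNat, by
    have := hr ⟨i, i.2.trans (j.2.trans (Nat.lt_succ_self k))⟩ i.2
    rw [Int.abs_eq_natAbs] at this
    omega⟩ with ha
  have hcoef : ∀ i : Fin k, (i : ℕ) < j → redCoef a i = w' i.castSucc := by
    intro i hi
    rw [redCoef, dif_pos hi]
    exact Int.toNat_of_nonneg (hr i.castSucc (by simpa using hi)).1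
  have hmain : v = Function.update v' j
      (d • v' j + ∑ i, (if i = j then 0 else redCoef a i) • v' i) := by
    have hsum : v j = d • v' j + ∑ i, (if i = j then 0 else redCoef a i) • v' i := by
      rw [hvj]
      have : d • v' j = ∑ i, (if i = j then d • v' j else 0) := by
        rw [Finset.sum_ite_eq' Finset.univ j, if_pos (Finset.mem_univ _)]
      rw [this, ← Finset.sum_add_distrib]
      refine Finset.sum_congr rfl fun i _ => ?_
      by_cases hij : i = j
      · subst hij
        rw [if_pos rfl, if_pos rfl, zero_smul, add_zero, hv'j, hdj]
      · rw [if_neg hij, if_neg hij, zero_add, hv'ne i hij]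
        rcases lt_or_gt_of_ne (Fin.val_ne_of_ne hij) with hlt | hgt
        · rw [hcoef i hlt, hrow i hlt]
        · rw [h0 i.castSucc (by simpa using hgt), redCoef, dif_neg (by omega), zero_smul, zero_smul]
    funext i
    by_cases hij : i = j
    · subst hij
      rw [Function.update_self, hsum]
    · rw [Function.update_of_ne hij, hv'ne i hij]
  refine ⟨d, hd, a, v', ⟨?_, η, fun i hi => ?_⟩, hmain⟩
  · refine linearIndependent_of_mem_span hLI fun i => ?_
    by_cases hij : i = j
    · rw [hij]
      have : intTup v j = (d : ℝ) • intTup v' j +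
          ∑ i, ((if i = j then 0 else redCoef a i : ℤ) : ℝ) • intTup v' i := by
        have h5 := congrFun hmain j
        rw [Function.update_self] at h5
        funext l
        have h6 := congrFun h5 l
        simp only [Pi.add_apply, Finset.sum_apply, Pi.smul_apply, smul_eq_mul, intTup,
          intVec] at h6 ⊢
        rw [h6]
        push_cast
        rfl
      rw [this]
      exact Submodule.add_mem _ (Submodule.smul_mem _ _ (Submodule.subset_span ⟨j, rfl⟩))
        (Submodule.sum_mem _ fun i _ => Submodule.smul_mem _ _ (Submodule.subset_span ⟨i, rfl⟩))
    · have : intTup v i = intTup v' i := by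
        unfold intTup
        rw [hv'ne i hij]
      rw [this]
      exact Submodule.subset_span ⟨i, rfl⟩
  · by_cases hij : i = j
    · rw [hij, hv'j]
    · rw [hv'ne i hij]
      refine hrow i ?_
      have := Fin.val_ne_of_ne hij
      omega

end

section

variable {k n : ℕ} {μ : Measure (SLR (k + 1))} [μ.IsHaarMeasure] {F : Set (SLR (k + 1))}

/-- The combination of the other vectors that is added in a Hermite reduction step. -/
def redShift (j : Fin k) {m : ℕ} (a : Fin (j : ℕ) → Fin m) (y : Fin k → Fin n → ℝ) : Fin n → ℝ :=
  ∑ i, ((if i = j then 0 else redCoef a i : ℤ) : ℝ) • y i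

theorem measurable_redShift (j : Fin k) {m : ℕ} (a : Fin (j : ℕ) → Fin m) :
    Measurable (redShift (n := n) j a) := by
  unfold redShift
  exact Finset.measurable_sum _ fun i _ => by fun_prop

/-- The inverse of a Hermite reduction step. -/
def redStep (j : Fin k) (d : ℤ) (a : Fin (j : ℕ) → Fin d.natAbs) (y : Fin k → Fin n → ℝ) :
    Fin k → Fin n → ℝ :=
  Function.update y j ((d : ℝ) • y j + redShift j a y)

theorem measurable_redStep (j : Fin k) (d : ℤ) (a : Fin (j : ℕ) → Fin d.natAbs) :
    Measurable (redStep (n := n) j d a) := by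
  refine measurable_pi_lambda _ fun i => ?_
  by_cases h : i = j
  · subst h
    simp only [redStep, Function.update_self]
    exact ((measurable_pi_apply _).const_smul (d : ℝ)).add (measurable_redShift _ a)
  · simp only [redStep, Function.update_of_ne h]
    exact measurable_pi_apply i

theorem lintegral_redStep (j : Fin k) {d : ℤ} (hd : d ≠ 0) (a : Fin (j : ℕ) → Fin d.natAbs)
    {f : (Fin k → Fin n → ℝ) → ENNReal} (hf : Measurable f) :
    ∫⁻ y, f (redStep j d a y) = ENNReal.ofReal (|(d : ℝ)| ^ n)⁻¹ * ∫⁻ y, f y := by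
  obtain ⟨m, rfl⟩ : ∃ m, k = m + 1 := ⟨k - 1, by have := j.2; omega⟩
  refine lintegral_update j (Int.cast_ne_zero.2 hd) (measurable_redShift j a) (fun y z => ?_) hf
  refine Finset.sum_congr rfl fun i _ => ?_
  by_cases h : i = j
  · simp [h]
  · rw [Function.update_of_ne h]

theorem redStep_act (j : Fin k) (d : ℤ) (a : Fin (j : ℕ) → Fin d.natAbs) (y : Fin k → Fin n → ℝ)
    (g : SLR n) : redStep j d a (act y g) = act (redStep j d a y) g := by
  funext i
  by_cases h : i = j
  · subst h
    simp only [redStep, act, Function.update_self, redShift, Matrix.add_vecMul,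
      Matrix.smul_vecMul, Matrix.sum_vecMul]
  · simp only [redStep, act, Function.update_of_ne h]

theorem redStep_intTup (j : Fin k) (d : ℤ) (a : Fin (j : ℕ) → Fin d.natAbs)
    (v : Fin k → Fin n → ℤ) : redStep j d a (intTup v) = intTup (Function.update v j
      (d • v j + ∑ i, (if i = j then 0 else redCoef a i) • v i)) := by
  funext i
  by_cases h : i = j
  · subst h
    funext l
    simp only [redStep, intTup, intVec, Function.update_self, redShift, Pi.add_apply,
      Finset.sum_apply, Pi.smul_apply, smul_eq_mul]
    push_cast
    rfl
  · simp only [redStep, intTup, Function.update_of_ne h]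

theorem tsum_frameTup_le (j : Fin k) (f : (Fin k → Fin (k + 1) → ℝ) → ENNReal) (g : SLR (k + 1)) :
    ∑' v : frameTup k j, f (act (intTup v.1) g) ≤
      ∑' d : {d : ℤ // d ≠ 0}, ∑ a : Fin (j : ℕ) → Fin d.1.natAbs,
        ∑' v : frameTup k (j + 1), f (redStep j d.1 a (act (intTup v.1) g)) := by
  choose d hd a v' hv' h using fun v : frameTup k j => exists_frameTup_succ j v.2
  let ι : frameTup k j → Σ d : {d : ℤ // d ≠ 0}, Σ _ : Fin (j : ℕ) → Fin d.1.natAbs,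
    frameTup k (j + 1) := fun v => ⟨⟨d v, hd v⟩, ⟨a v, ⟨v' v, hv' v⟩⟩⟩
  let G : (Σ d : {d : ℤ // d ≠ 0}, Σ _ : Fin (j : ℕ) → Fin d.1.natAbs, frameTup k (j + 1)) →
    ENNReal := fun s => f (redStep j s.1.1 s.2.1 (act (intTup s.2.2.1) g))
  let R : (Σ d : {d : ℤ // d ≠ 0}, Σ _ : Fin (j : ℕ) → Fin d.1.natAbs, frameTup k (j + 1)) →
    Fin k → Fin (k + 1) → ℤ := fun s => Function.update s.2.2.1 j
      (s.1.1 • s.2.2.1 j + ∑ i, (if i = j then 0 else redCoef s.2.1 i) • s.2.2.1 i)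
  have hR : ∀ v, R (ι v) = v.1 := fun v => (h v).symm
  have hι : Function.Injective ι := fun u v huv =>
    Subtype.ext (by rw [← hR u, ← hR v, huv])
  have hG : ∀ v : frameTup k j, f (act (intTup v.1) g) = G (ι v) := by
    intro v
    simp only [G]
    rw [redStep_act, redStep_intTup]
    exact congrArg (fun u => f (act (intTup u) g)) (hR v).symm
  calc ∑' v : frameTup k j, f (act (intTup v.1) g) = ∑' v, G (ι v) := tsum_congr hG
    _ ≤ ∑' s, G s := ENNReal.tsum_comp_le_tsum_of_injective hι G
    _ = _ := by
      rw [ENNReal.tsum_sigma']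
      refine tsum_congr fun d => ?_
      rw [ENNReal.tsum_sigma', tsum_fintype]

theorem measurable_tsum_act (I : Set (Fin k → Fin n → ℤ)) {f : (Fin k → Fin n → ℝ) → ENNReal}
    (hf : Measurable f) : Measurable fun g : SLR n => ∑' v : I, f (act (intTup v.1) g) :=
  Measurable.tsum fun _ => hf.comp (measurable_act_left _)

theorem siegelConst_frameTup_le (hF : IsFundamentalDomain (Gam (k + 1)) F μ) (h1 : μ F = 1)
    (j : Fin k) : siegelConst μ F (frameTup k j) ≤
      (∑' d : {d : ℤ // d ≠ 0}, (d.1.natAbs : ENNReal) ^ (j : ℕ) *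
        ENNReal.ofReal (|(d.1 : ℝ)| ^ (k + 1))⁻¹) * siegelConst μ F (frameTup k (j + 1)) := by
  set f : (Fin k → Fin (k + 1) → ℝ) → ENNReal := (Set.Icc 0 1).indicator 1 with hfdef
  have hf : Measurable f := measurable_one.indicator measurableSet_Icc
  have hf1 : ∫⁻ y, f y = 1 := by
    rw [hfdef, lintegral_indicator_one measurableSet_Icc, volume_Icc_tuples]
  have e0 := lintegral_tsum_act hF h1 (Nat.lt_succ_self k) (invTup_frameTup (k := k) j)
    (indepTup_frameTup j) hf
  rw [hf1, mul_one] at e0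
  rw [← e0]
  refine (lintegral_mono fun g => tsum_frameTup_le j f g).trans (le_of_eq ?_)
  have hm : ∀ (d : {d : ℤ // d ≠ 0}) (a : Fin (j : ℕ) → Fin d.1.natAbs), Measurable
      fun g : SLR (k + 1) => ∑' v : frameTup k (j + 1), f (redStep j d.1 a (act (intTup v.1) g)) :=
    fun d a => measurable_tsum_act _ (hf.comp (measurable_redStep j d.1 a))
  rw [lintegral_tsum fun d => (Finset.measurable_sum _ fun a _ => hm d a).aemeasurable,
    ← ENNReal.tsum_mul_right]
  refine tsum_congr fun d => ?_
  rw [lintegral_finsetSum _ fun a _ => hm d a]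
  have : ∀ a : Fin (j : ℕ) → Fin d.1.natAbs, ∫⁻ g in F, ∑' v : frameTup k (j + 1),
      f (redStep j d.1 a (act (intTup v.1) g)) ∂μ =
      ENNReal.ofReal (|(d.1 : ℝ)| ^ (k + 1))⁻¹ * siegelConst μ F (frameTup k (j + 1)) := by
    intro a
    rw [lintegral_tsum_act hF h1 (Nat.lt_succ_self k) (invTup_frameTup (k := k) (j + 1))
      (indepTup_frameTup _) (f := fun y => f (redStep j d.1 a y))
      (hf.comp (measurable_redStep j d.1 a)),
      lintegral_redStep j d.2 a hf, hf1, mul_one, mul_comm]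
  rw [Finset.sum_congr rfl fun a _ => this a, Finset.sum_const, nsmul_eq_mul, mul_assoc]
  simp

theorem tsum_int_pow_inv_lt_top {j m : ℕ} (hj : j + 2 ≤ m) :
    ∑' d : {d : ℤ // d ≠ 0}, (d.1.natAbs : ENNReal) ^ j * ENNReal.ofReal (|(d.1 : ℝ)| ^ m)⁻¹
      < ⊤ := by
  have hs : Summable fun d : ℤ => |1 / (d : ℝ) ^ 2| :=
    (Real.summable_one_div_int_pow.2 one_lt_two).abs
  refine lt_of_le_of_lt ?_ hs.tsum_ofReal_lt_top
  refine le_trans (ENNReal.tsum_le_tsum fun d => ?_) (ENNReal.tsum_comp_le_tsum_of_injective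
    Subtype.val_injective fun d : ℤ => ENNReal.ofReal |1 / (d : ℝ) ^ 2|)
  have h1 : ((d.1.natAbs : ℕ) : ENNReal) = ENNReal.ofReal |(d.1 : ℝ)| := by
    rw [← ENNReal.ofReal_natCast, Nat.cast_natAbs, Int.cast_abs]
  have hd : (1 : ℝ) ≤ |(d.1 : ℝ)| := by
    rw [← Int.cast_abs]
    exact_mod_cast Int.one_le_abs d.2
  rw [h1, ← ENNReal.ofReal_pow (abs_nonneg _), ← ENNReal.ofReal_mul (by positivity)]
  refine ENNReal.ofReal_le_ofReal ?_
  have h0 : (0 : ℝ) < |(d.1 : ℝ)| := lt_of_lt_of_le one_pos hd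
  rw [abs_div, abs_one, abs_pow, ← div_eq_mul_inv, div_le_div_iff₀ (pow_pos h0 _) (pow_pos h0 _),
    one_mul, ← pow_add]
  exact pow_le_pow_right₀ hd hj

theorem siegelConst_frameTup_lt_top (hF : IsFundamentalDomain (Gam (k + 1)) F μ) (h1 : μ F = 1)
    (hk : siegelConst μ F (frameTup k k) < ⊤) : siegelConst μ F (frameTup k 0) < ⊤ := by
  have key : ∀ i, i ≤ k → siegelConst μ F (frameTup k (k - i)) < ⊤ := by
    intro i
    induction i with
    | zero => exact fun _ => hk
    | succ i ih =>
      intro hi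
      have h := siegelConst_frameTup_le hF h1 (⟨k - (i + 1), by omega⟩ : Fin k)
      refine lt_of_le_of_lt h (ENNReal.mul_lt_top (tsum_int_pow_inv_lt_top
        (by dsimp only; omega)) ?_)
      dsimp only
      rw [show k - (i + 1) + 1 = k - i by omega]
      exact ih (by omega)
  simpa using key k le_rfl

end

section

variable {k n : ℕ} {μ : Measure (SLR (k + 1))} [μ.IsHaarMeasure] {F : Set (SLR (k + 1))}

/-- The square matrix with given first rows and with the last standard vector as last row. -/
def snocMat (y : Fin k → Fin (k + 1) → ℝ) : Matrix (Fin (k + 1)) (Fin (k + 1)) ℝ :=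
  Matrix.of (Fin.snoc y (Pi.single (Fin.last k) 1) : Fin (k + 1) → Fin (k + 1) → ℝ)

theorem continuous_snocMat : Continuous (snocMat (k := k)) := by
  have h : Continuous fun y : Fin k → Fin (k + 1) → ℝ =>
      (Fin.snoc y (Pi.single (Fin.last k) 1) : Fin (k + 1) → Fin (k + 1) → ℝ) := by
    refine continuous_pi fun i => ?_
    refine Fin.lastCases ?_ (fun i => ?_) i
    · simpa using continuous_const
    · simpa using continuous_apply i
  exact h

/-- Completion of a tuple of rows by a combination of the rows and the last standard vector. -/
def complRows (p : (Fin k → Fin (k + 1) → ℝ) × (Fin (k + 1) → ℝ)) :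
    Fin (k + 1) → Fin (k + 1) → ℝ :=
  fun i => (snocMat p.1).updateRow (Fin.last k) (p.2 ᵥ* snocMat p.1) i

theorem continuous_complRows : Continuous (complRows (k := k)) := by
  have h1 : Continuous fun p : (Fin k → Fin (k + 1) → ℝ) × (Fin (k + 1) → ℝ) => snocMat p.1 :=
    continuous_snocMat.comp continuous_fst
  have h2 : Continuous fun p : (Fin k → Fin (k + 1) → ℝ) × (Fin (k + 1) → ℝ) =>
      p.2 ᵥ* snocMat p.1 := Continuous.matrix_vecMul continuous_snd h1
  exact h1.matrix_updateRow (Fin.last k) h2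

theorem det_updateRow_vecMul {R : Type*} [CommRing R] {m : ℕ} (A : Matrix (Fin m) (Fin m) R)
    (j : Fin m) (c : Fin m → R) : (A.updateRow j (c ᵥ* A)).det = c j * A.det := by
  rw [Matrix.vecMul_eq_sum]
  exact Matrix.det_updateRow_sum A j c

/-- A neighbourhood of the first standard vectors. -/
def nearFrame (k : ℕ) : Set (Fin k → Fin (k + 1) → ℝ) :=
  {y | 1 / 2 ≤ (snocMat y).det} ∩ Metric.closedBall 0 2

/-- The compact set of matrices completing tuples in `nearFrame`. -/
def nearSL (k : ℕ) : Set (SLR (k + 1)) :=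
  rows ⁻¹' (complRows '' (nearFrame k ×ˢ Set.Icc (-2) 2))

theorem isClosed_nearFrame : IsClosed (nearFrame k) :=
  (isClosed_le continuous_const continuous_snocMat.matrix_det).inter Metric.isClosed_closedBall

theorem isCompact_nearFrame : IsCompact (nearFrame k) :=
  (isCompact_closedBall _ _).of_isClosed_subset isClosed_nearFrame Set.inter_subset_right

theorem isCompact_nearSL : IsCompact (nearSL k) :=
  isClosedEmbedding_rows.isCompact_preimage
    ((isCompact_nearFrame.prod isCompact_Icc).image continuous_complRows)

theorem volume_nearFrame_pos : 0 < volume (nearFrame k) := by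
  set U : Set (Fin k → Fin (k + 1) → ℝ) := {y | 1 / 2 < (snocMat y).det} ∩ Metric.ball 0 2
  have hU : IsOpen U :=
    (isOpen_lt continuous_const continuous_snocMat.matrix_det).inter Metric.isOpen_ball
  have hUs : U ⊆ nearFrame k := fun y hy => by
    have h : 1 / 2 < (snocMat y).det := hy.1
    exact ⟨h.le, Metric.ball_subset_closedBall hy.2⟩
  refine lt_of_lt_of_le (hU.measure_pos volume ⟨fun i => Pi.single i.castSucc 1, ?_, ?_⟩)
    (measure_mono hUs)
  · have : snocMat (fun i : Fin k => (Pi.single i.castSucc 1 : Fin (k + 1) → ℝ)) = 1 := by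
      ext i j
      refine Fin.lastCases ?_ (fun i => ?_) i <;> simp [snocMat, Matrix.one_apply,
        Pi.single_apply, eq_comm]
    rw [Set.mem_ofPred_eq, this, Matrix.det_one]
    norm_num
  · rw [mem_ball_zero_iff, pi_norm_lt_iff two_pos]
    intro i
    rw [pi_norm_lt_iff two_pos]
    intro j
    by_cases h : j = i.castSucc <;> simp [h]

/-- Primitive tuples near the standard frame are completed by bounded elements of the orbit. -/
theorem exists_mem_nearSL {v : Fin k → Fin (k + 1) → ℤ} (hv : v ∈ frameTup k k) {g : SLR (k + 1)}
    (hg : act (intTup v) g ∈ nearFrame k) : ∃ γ : Matrix.SpecialLinearGroup (Fin (k + 1)) ℤ,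
      (∀ i : Fin k, v i = γ.1 i.castSucc) ∧
      Matrix.SpecialLinearGroup.map (Int.castRingHom ℝ) γ * g ∈ nearSL k := by
  obtain ⟨-, γ, hγ⟩ := hv
  have hγ' : ∀ i : Fin k, v i = γ.1 i.castSucc := fun i => by
    rw [hγ i i.2, Matrix.single_one_vecMul]
    rfl
  set y := act (intTup v) g with hy
  set M := snocMat y with hM
  have hdet : 1 / 2 ≤ M.det := hg.1
  set r : Fin (k + 1) → ℝ := intVec (γ.1 (Fin.last k)) ᵥ* g.1 with hr
  set c := r ᵥ* M⁻¹ with hc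
  have hcM : c ᵥ* M = r := by
    rw [hc, Matrix.vecMul_vecMul, Matrix.nonsing_inv_mul, Matrix.vecMul_one]
    exact (ne_of_gt (by linarith : 0 < M.det)).isUnit
  set q : Fin (k + 1) → ℤ := fun i => if i = Fin.last k then 1 else -⌊c i⌋ with hq
  set γ' : Matrix.SpecialLinearGroup (Fin (k + 1)) ℤ :=
    ⟨γ.1.updateRow (Fin.last k) (q ᵥ* γ.1), by
      rw [det_updateRow_vecMul, γ.2, hq]
      simp⟩ with hγdef
  set c' : Fin (k + 1) → ℝ := fun i => if i = Fin.last k then c i else Int.fract (c i) with hc'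
  set P : Matrix (Fin (k + 1)) (Fin (k + 1)) ℝ := (γ.1.map fun x : ℤ => (x : ℝ)) * g.1 with hP
  have hProw : ∀ i, P i = intVec (γ.1 i) ᵥ* g.1 := fun i => rfl
  have hPlast : P (Fin.last k) = r := hProw _
  have hPi : ∀ i : Fin k, P i.castSucc = y i := fun i => by
    rw [hProw, ← hγ']
    rfl
  refine ⟨γ', fun i => ?_, ?_⟩
  · rw [hγ' i, hγdef]
    simp
  have hrows : rows (Matrix.SpecialLinearGroup.map (Int.castRingHom ℝ) γ' * g) =
      complRows (y, c') := by
    have e1 : rows (Matrix.SpecialLinearGroup.map (Int.castRingHom ℝ) γ' * g) =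
        fun i => (intVec (γ'.1 i)) ᵥ* g.1 := rfl
    rw [e1]
    funext i
    refine Fin.lastCases ?_ (fun i => ?_) i
    · have e2 : intVec (γ'.1 (Fin.last k)) ᵥ* g.1 = intVec q ᵥ* P := by
        rw [hP, ← Matrix.vecMul_vecMul, hγdef]
        congr 1
        funext l
        simp [intVec, Matrix.vecMul, dotProduct]
      have e3 : complRows (y, c') (Fin.last k) = c' ᵥ* M := by
        simp [complRows, hM]
      rw [e2, e3, Matrix.vecMul_eq_sum, Matrix.vecMul_eq_sum, Fin.sum_univ_castSucc,
        Fin.sum_univ_castSucc, hPlast, ← hcM, Matrix.vecMul_eq_sum, Fin.sum_univ_castSucc]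
      have hq1 : intVec q (Fin.last k) = 1 := by simp [intVec, hq]
      have hc1 : c' (Fin.last k) = c (Fin.last k) := by simp [hc']
      rw [hq1, hc1, one_smul, ← add_assoc, ← Finset.sum_add_distrib]
      congr 1
      refine Finset.sum_congr rfl fun i _ => ?_
      have hMi : M i.castSucc = y i := by
        funext l
        simp [hM, snocMat]
      rw [hPi, hMi, ← add_smul]
      congr 1
      have hne : i.castSucc ≠ Fin.last k := (Fin.castSucc_lt_last i).ne
      simp only [intVec, hq, hc', if_neg hne, Int.fract]
      push_cast
      ring
    · have e3 : complRows (y, c') i.castSucc = y i := by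
        funext l
        have hne : i.castSucc ≠ Fin.last k := (Fin.castSucc_lt_last i).ne
        simp [complRows, snocMat]
      rw [e3, hγdef]
      simp only [Matrix.updateRow_ne (Fin.castSucc_lt_last i).ne, ← hγ']
      rfl
  refine ⟨(y, c'), ⟨hg, ?_⟩, hrows.symm⟩
  have hlast : c (Fin.last k) * M.det = 1 := by
    rw [← det_updateRow_vecMul, hcM]
    have : M.updateRow (Fin.last k) r = P := by
      ext i l
      refine Fin.lastCases ?_ (fun i => ?_) i
      · rw [Matrix.updateRow_self, ← hPlast]
      · rw [Matrix.updateRow_ne (Fin.castSucc_lt_last i).ne, hPi]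
        simp [hM, snocMat]
    rw [this, hP, Matrix.det_mul, g.2, mul_one]
    have := (Matrix.SpecialLinearGroup.map (Int.castRingHom ℝ) γ).2
    exact this
  have hb : ∀ i, -2 ≤ c' i ∧ c' i ≤ 2 := by
    intro i
    by_cases hi : i = Fin.last k
    · have : c (Fin.last k) = 1 / M.det := by
        rw [eq_div_iff (by linarith : (0 : ℝ) < M.det).ne', hlast]
      have hci : c' i = 1 / M.det := by
        rw [hc']
        dsimp only
        rw [if_pos hi, hi, this]
      rw [hci]
      have h0 : 0 < 1 / M.det := by positivity
      refine ⟨by linarith, ?_⟩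
      rw [div_le_iff₀ (by linarith)]
      linarith
    · simp only [hc', if_neg hi]
      have h0 := Int.fract_nonneg (c i)
      have h1 := Int.fract_lt_one (c i)
      constructor <;> linarith
  exact ⟨fun i => (hb i).1, fun i => (hb i).2⟩

/-- The mean value constant of primitive tuples is finite. -/
theorem siegelConst_prim_lt_top (hF : IsFundamentalDomain (Gam (k + 1)) F μ) (h1 : μ F = 1) :
    siegelConst μ F (frameTup k k) < ⊤ := by
  set f : (Fin k → Fin (k + 1) → ℝ) → ENNReal := (nearFrame k).indicator 1 with hfdef
  have hf : Measurable f := measurable_one.indicator isClosed_nearFrame.measurableSet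
  have e0 := lintegral_tsum_act hF h1 (Nat.lt_succ_self k) (invTup_frameTup (k := k) k)
    (indepTup_frameTup k) hf
  have hle : ∀ g : SLR (k + 1), ∑' v : frameTup k k, f (act (intTup v.1) g) ≤
      ∑' γ : Gam (k + 1), (nearSL k).indicator 1 (γ⁻¹ • g) := by
    intro g
    choose! Γ hΓ hΓ' using fun (v : frameTup k k) (h : act (intTup v.1) g ∈ nearFrame k) =>
      exists_mem_nearSL v.2 h
    rw [← tsum_subtype_eq_of_support_subset
      (s := {v : frameTup k k | act (intTup v.1) g ∈ nearFrame k})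
      (f := fun v : frameTup k k => f (act (intTup v.1) g))]
    · let ι : {v : frameTup k k | act (intTup v.1) g ∈ nearFrame k} → Gam (k + 1) := fun v =>
        ⟨Matrix.SpecialLinearGroup.map (Int.castRingHom ℝ) (Γ v.1), ⟨_, rfl⟩⟩⁻¹
      have hι : Function.Injective ι := by
        intro u v huv
        have h3 := congrArg Subtype.val (inv_injective huv)
        have h4 : Γ u.1 = Γ v.1 := by
          ext i j
          have h5 := congrArg (fun m : SLR (k + 1) => m.1 i j) h3
          simpa using h5
        refine Subtype.ext (Subtype.ext (funext fun i => ?_))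
        rw [hΓ u.1 u.2 i, hΓ v.1 v.2 i, h4]
      refine le_trans (le_of_eq (tsum_congr fun v => ?_)) (ENNReal.tsum_comp_le_tsum_of_injective hι
        fun γ : Gam (k + 1) => (nearSL k).indicator 1 (γ⁻¹ • g))
      have h6 : act (intTup v.1.1) g ∈ nearFrame k := v.2
      rw [hfdef, Set.indicator_of_mem h6, Set.indicator_of_mem]
      · rfl
      · simp only [ι, inv_inv]
        exact hΓ' v.1 v.2
    · intro v hv
      by_contra h
      have h6 : act (intTup v.1) g ∉ nearFrame k := h
      exact hv (Set.indicator_of_notMem h6 _)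
  have hμ : μ (nearSL k) < ⊤ := isCompact_nearSL.measure_lt_top
  have h2 : siegelConst μ F (frameTup k k) * volume (nearFrame k) < ⊤ := by
    rw [hfdef, lintegral_indicator_one isClosed_nearFrame.measurableSet] at e0
    rw [← e0]
    refine lt_of_le_of_lt (lintegral_mono hle) ?_
    have hm : MeasurableSet (nearSL k) := isCompact_nearSL.measurableSet
    rw [lintegral_tsum, ← hF.lintegral_eq_tsum', lintegral_indicator_one hm]
    · exact hμ
    · intro γ
      exact ((measurable_one.indicator hm).comp (measurable_const_smul γ⁻¹)).aemeasurable
  by_contra h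
  rw [not_lt, top_le_iff] at h
  rw [h, ENNReal.top_mul volume_nearFrame_pos.ne'] at h2
  exact lt_irrefl _ h2

end

section

open Filter Topology Pointwise
variable {k n : ℕ}

/-- The number of lattice points in a set, as an extended non-negative real. -/
def latN (g : SLR n) (A : Set (Fin n → ℝ)) : ENNReal :=
  ∑' w : Fin n → ℤ, A.indicator 1 (vact (intVec w) g)

/-- The cube of side `2R` centred at the origin. -/
def cube (n : ℕ) (R : ℝ) : Set (Fin n → ℝ) := Set.Icc (fun _ => -R) (fun _ => R)

theorem mem_cube {R : ℝ} {x : Fin n → ℝ} : x ∈ cube n R ↔ ∀ i, |x i| ≤ R := by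
  simp only [cube, Set.mem_Icc, Pi.le_def, abs_le, forall_and]

theorem measurableSet_cube (R : ℝ) : MeasurableSet (cube n R) := measurableSet_Icc

theorem volume_cube (R : ℝ) : volume (cube n R) = ENNReal.ofReal (2 * R) ^ n := by
  rw [cube, Real.volume_Icc_pi]
  simp [two_mul]

theorem isBounded_cube (R : ℝ) : Bornology.IsBounded (cube n R) := Metric.isBounded_Icc _ _

theorem vact_inv (g : SLR n) (z : Fin n → ℝ) : vact (vact z g) g⁻¹ = z := by
  rw [vact, vact, Matrix.vecMul_vecMul, ← Matrix.SpecialLinearGroup.coe_mul, mul_inv_cancel,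
    Matrix.SpecialLinearGroup.coe_one, Matrix.vecMul_one]

theorem vact_inv' (g : SLR n) (z : Fin n → ℝ) : vact (vact z g⁻¹) g = z := by
  have := vact_inv g⁻¹ z
  rwa [inv_inv] at this

theorem vact_add (g : SLR n) (z w : Fin n → ℝ) : vact (z + w) g = vact z g + vact w g :=
  Matrix.add_vecMul _ _ _

theorem vact_sub (g : SLR n) (z w : Fin n → ℝ) : vact (z - w) g = vact z g - vact w g :=
  Matrix.sub_vecMul _ _ _

theorem vact_smul (g : SLR n) (c : ℝ) (z : Fin n → ℝ) : vact (c • z) g = c • vact z g :=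
  Matrix.smul_vecMul _ _ _

theorem intVec_sub (z w : Fin n → ℤ) : intVec (z - w) = intVec z - intVec w := by
  funext i
  simp [intVec]

theorem continuous_vact (g : SLR n) : Continuous fun z => vact z g :=
  Continuous.matrix_vecMul continuous_id continuous_const

theorem finite_intVec_mem {B : Set (Fin n → ℝ)} (hB : Bornology.IsBounded B) :
    {w : Fin n → ℤ | intVec w ∈ B}.Finite := by
  obtain ⟨R, hR⟩ := hB.subset_closedBall 0
  refine (Set.finite_Icc (fun _ => -⌈R⌉ : Fin n → ℤ) (fun _ => ⌈R⌉)).subset fun w hw => ?_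
  have h := hR hw
  rw [mem_closedBall_zero_iff] at h
  have h2 : ∀ i, |(w i : ℝ)| ≤ (⌈R⌉ : ℝ) := fun i =>
    ((norm_le_pi_norm (intVec w) i).trans h).trans (Int.le_ceil R)
  exact ⟨fun i => by have := (abs_le.1 (h2 i)).1; exact_mod_cast this,
    fun i => by have := (abs_le.1 (h2 i)).2; exact_mod_cast this⟩

theorem finite_lat (g : SLR n) {A : Set (Fin n → ℝ)} (hA : Bornology.IsBounded A) :
    {w : Fin n → ℤ | vact (intVec w) g ∈ A}.Finite := by
  obtain ⟨R, hR⟩ := hA.subset_closedBall 0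
  have hc := ((isCompact_closedBall (0 : Fin n → ℝ) R).image (continuous_vact g⁻¹)).isBounded
  refine (finite_intVec_mem hc).subset fun w hw => ⟨vact (intVec w) g, hR hw, vact_inv g _⟩

theorem latN_eq_card (g : SLR n) (A : Set (Fin n → ℝ)) :
    latN g A = ENat.toENNReal ({w : Fin n → ℤ | vact (intVec w) g ∈ A}.encard) := by
  rw [← ENNReal.tsum_set_one, tsum_subtype _ (fun _ => (1 : ENNReal))]
  rfl

theorem latN_eq_natCard (g : SLR n) {A : Set (Fin n → ℝ)} (hA : Bornology.IsBounded A) :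
    latN g A = (Nat.card {w : Fin n → ℤ | vact (intVec w) g ∈ A} : ENNReal) := by
  rw [latN_eq_card, Nat.card_coe_set_eq, ← (finite_lat g hA).cast_ncard_eq]
  simp

theorem latN_lt_top (g : SLR n) {A : Set (Fin n → ℝ)} (hA : Bornology.IsBounded A) :
    latN g A < ⊤ := by
  rw [latN_eq_natCard g hA]
  exact ENNReal.natCast_lt_top _

theorem latN_mono (g : SLR n) {A B : Set (Fin n → ℝ)} (h : A ⊆ B) : latN g A ≤ latN g B :=
  ENNReal.tsum_le_tsum fun _ => Set.indicator_le_indicator_of_subset h (fun _ => zero_le) _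

theorem tsum_translate (g : SLR n) (A : Set (Fin n → ℝ)) (w₀ : Fin n → ℤ) :
    ∑' w : Fin n → ℤ, A.indicator (1 : (Fin n → ℝ) → ENNReal) (vact (intVec w) g - vact
      (intVec w₀) g) =
      latN g A := by
  rw [latN, ← (Equiv.subRight w₀).tsum_eq (fun w => A.indicator 1 (vact (intVec w) g))]
  simp [intVec_sub, vact_sub]

theorem latN_cube_le (g : SLR n) (m : ℕ) :
    latN g (cube n m) ≤ (2 * m + 1 : ENNReal) ^ n * latN g (cube n 1) := by
  set S : Finset (Fin n → ℤ) := Finset.Icc (fun _ => -(m : ℤ)) (fun _ => (m : ℤ)) with hS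
  have hcard : (S.card : ENNReal) = (2 * m + 1 : ENNReal) ^ n := by
    rw [hS, Pi.card_Icc]
    simp only [Int.card_Icc, Finset.prod_const, Finset.card_univ, Fintype.card_fin]
    rw [show ((m : ℤ) + 1 - -(m : ℤ)).toNat = 2 * m + 1 by omega]
    push_cast
    rfl
  set cell : (Fin n → ℤ) → Set (Fin n → ℝ) := fun c => {x | ∀ i, ⌊x i⌋ = c i}
  have hcell : ∀ c, latN g (cell c) ≤ latN g (cube n 1) := by
    intro c
    by_cases h : ∃ w₀, vact (intVec w₀) g ∈ cell c
    · obtain ⟨w₀, h₀⟩ := h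
      rw [← tsum_translate g (cube n 1) w₀]
      refine ENNReal.tsum_le_tsum fun w => Set.indicator_apply_le' (fun hw => ?_) fun _ => zero_le
      rw [Set.indicator_of_mem]
      · rfl
      · rw [mem_cube]
        intro i
        rw [Pi.sub_apply]
        exact (Int.abs_sub_lt_one_of_floor_eq_floor ((hw i).trans (h₀ i).symm)).le
    · rw [not_exists] at h
      rw [latN, ENNReal.tsum_eq_zero.2 fun w => Set.indicator_of_notMem (h w) _]
      exact zero_le
  calc latN g (cube n m) ≤ ∑ c ∈ S, latN g (cell c) := by
        unfold latN
        rw [← Summable.tsum_finsetSum fun _ _ => ENNReal.summable]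
        refine ENNReal.tsum_le_tsum fun w => Set.indicator_apply_le' (fun hw => ?_) fun _ => zero_le
        set x := vact (intVec w) g
        have hx := mem_cube.1 hw
        have hmem : (fun i => ⌊x i⌋) ∈ S := by
          rw [hS, Finset.mem_Icc]
          refine ⟨fun i => Int.le_floor.2 ?_, fun i => ?_⟩
          · have := (abs_le.1 (hx i)).1
            push_cast
            exact this
          · have := (abs_le.1 (hx i)).2
            have h2 : (⌊x i⌋ : ℝ) ≤ m := (Int.floor_le _).trans this
            exact_mod_cast h2
        refine le_trans ?_ (Finset.single_le_sum (f := fun c => (cell c).indicator (1 :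
          (Fin n → ℝ) → ENNReal) x)
          (fun _ _ => zero_le) hmem)
        rw [Set.indicator_of_mem]
        intro i
        rfl
    _ ≤ ∑ c ∈ S, latN g (cube n 1) := Finset.sum_le_sum fun c _ => hcell c
    _ = _ := by rw [Finset.sum_const, nsmul_eq_mul, hcard]

theorem tendsto_latN_cube (g : SLR n) :
    Tendsto (fun m : ℕ => latN g (cube n m) / (2 * m : ENNReal) ^ n) atTop (𝓝 1) := by
  set s : Set (Fin n → ℝ) := (fun z => vact z g) ⁻¹' cube n 1 with hs
  have hsb : Bornology.IsBounded s := by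
    refine (((isCompact_Icc (a := fun _ : Fin n => (-1 : ℝ)) (b := fun _ => 1)).image
      (continuous_vact g⁻¹)).isBounded).subset fun z hz => ⟨vact z g, hz, vact_inv g z⟩
  have hsm : MeasurableSet s := measurable_vact g (measurableSet_cube 1)
  have hconv : Convex ℝ s := by
    intro x hx y hy a b ha hb hab
    have := (convex_Icc (fun _ : Fin n => (-1 : ℝ)) (fun _ => 1)) hx hy ha hb hab
    simpa only [hs, cube, Set.mem_preimage, vact_add, vact_smul] using this
  have hvol : volume.real s = 2 ^ n := by
    rw [Measure.real, hs, (measurePreserving_vact g).measure_preimage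
      (measurableSet_cube 1).nullMeasurableSet, volume_cube]
    simp
  have h := tendsto_card_div_pow_atTop_volume s hsb hsm (hconv.addHaar_frontier volume)
  rw [hvol] at h
  have h2 : Tendsto (fun m : ℕ => ENNReal.ofReal ((Nat.card
      {w : Fin n → ℤ | vact (intVec w) g ∈ cube n m} : ℝ) / m ^ n / 2 ^ n)) atTop (𝓝 1) := by
    have h3 := ENNReal.tendsto_ofReal (h.div_const (2 ^ n))
    rw [div_self (by positivity), ENNReal.ofReal_one] at h3
    refine h3.congr' ?_
    filter_upwards [eventually_ge_atTop 1] with m hm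
    have hm0 : (m : ℝ) ≠ 0 := by positivity
    rw [Fintype.card_fin]
    congr 4
    have h5 : ∀ w : {w : Fin n → ℤ | vact (intVec w) g ∈ cube n m}, (m : ℝ)⁻¹ • intVec w.1 ∈
        s ∩ (m : ℝ)⁻¹ • (Submodule.span ℤ (Set.range (Pi.basisFun ℝ (Fin n))) :
          Set (Fin n → ℝ)) := by
      intro w
      refine ⟨?_, Set.smul_mem_smul_set ?_⟩
      · rw [hs, Set.mem_preimage, vact_smul, mem_cube]
        intro i
        have := mem_cube.1 w.2 i
        rw [Pi.smul_apply, smul_eq_mul, abs_mul, abs_inv, Nat.abs_cast,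
          inv_mul_le_iff₀ (by positivity)]
        simpa using this
      · rw [SetLike.mem_coe, Module.Basis.mem_span_iff_repr_mem]
        intro i
        exact ⟨w.1 i, by simp [intVec]⟩
    refine Nat.card_congr (Equiv.ofBijective (fun w => ⟨_, h5 w⟩) ⟨?_, ?_⟩).symm
    · intro u w huw
      have := smul_right_injective _ (inv_ne_zero hm0) (congrArg Subtype.val huw)
      refine Subtype.ext (funext fun i => ?_)
      have h4 := congrFun this i
      simpa [intVec] using h4
    · rintro ⟨x, hx, y, hy, rfl⟩
      rw [SetLike.mem_coe, Module.Basis.mem_span_iff_repr_mem] at hy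
      choose w hw using hy
      have hwy : intVec w = y := by
        funext i
        simpa [intVec] using hw i
      refine ⟨⟨w, ?_⟩, Subtype.ext (by simp [hwy])⟩
      rw [Set.mem_ofPred_eq, hwy, mem_cube]
      intro i
      have := mem_cube.1 hx i
      simp only [vact_smul] at this
      rw [Pi.smul_apply, smul_eq_mul, abs_mul, abs_inv, Nat.abs_cast,
        inv_mul_le_iff₀ (by positivity)] at this
      simpa using this
  refine h2.congr' ?_
  filter_upwards [eventually_ge_atTop 1] with m hm
  rw [latN_eq_natCard g (isBounded_cube _), div_div, ← mul_pow,
    ENNReal.ofReal_div_of_pos (by positivity), ENNReal.ofReal_natCast,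
    ENNReal.ofReal_pow (by positivity), mul_comm (m : ℝ)]
  simp [ENNReal.ofReal_mul]

end

section

open Filter Topology
variable {k n : ℕ}

theorem intVec_nsmul (j : ℕ) (z : Fin n → ℤ) : intVec (j • z) = (j : ℝ) • intVec z := by
  funext i
  simp [intVec]

theorem exists_vact_notMem (g : SLR n) {W : Submodule ℝ (Fin n → ℝ)} (hW : W ≠ ⊤) :
    ∃ w : Fin n → ℤ, vact (intVec w) g ∉ W := by
  by_contra! h
  refine hW (eq_top_iff.2 fun x _ => ?_)
  rw [← vact_inv' g x]
  set z := vact x g⁻¹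
  have hz : vact z g = ∑ i, z i • vact (intVec (Pi.single i (1 : ℤ))) g := by
    have h1 : ∀ i : Fin n, vact (intVec (Pi.single i (1 : ℤ))) g = g.1 i := by
      intro i
      have : intVec (Pi.single i (1 : ℤ)) = (Pi.single i 1 : Fin n → ℝ) := by
        funext j
        by_cases h : j = i
        · subst h; simp [intVec]
        · simp [intVec, h]
      rw [this, vact, Matrix.single_one_vecMul]
      rfl
    simp only [h1]
    exact Matrix.vecMul_eq_sum z g.1
  rw [hz]
  exact W.sum_mem fun i _ => W.smul_mem _ (h _)

theorem mul_latN_inter_le (g : SLR n) {W : Submodule ℝ (Fin n → ℝ)} {w₀ : Fin n → ℤ}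
    (h₀ : vact (intVec w₀) g ∉ W) {r : ℕ} (hr : ∀ i, |vact (intVec w₀) g i| ≤ r) (J m : ℕ) :
    (J : ENNReal) * latN g (cube n m ∩ W) ≤ latN g (cube n (m + J * r : ℕ)) := by
  set u := vact (intVec w₀) g with hu
  calc (J : ENNReal) * latN g (cube n m ∩ W) = ∑ j ∈ Finset.range J, latN g (cube n m ∩ W) := by
        simp
    _ = ∑ j ∈ Finset.range J, ∑' w : Fin n → ℤ, (cube n m ∩ W).indicator
          (1 : (Fin n → ℝ) → ENNReal) (vact (intVec w) g - (j : ℝ) • u) := by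
        refine Finset.sum_congr rfl fun j _ => ?_
        rw [← tsum_translate g _ (j • w₀), intVec_nsmul, vact_smul]
    _ = ∑' w : Fin n → ℤ, ∑ j ∈ Finset.range J, (cube n m ∩ W).indicator
          (1 : (Fin n → ℝ) → ENNReal) (vact (intVec w) g - (j : ℝ) • u) :=
        (Summable.tsum_finsetSum fun _ _ => ENNReal.summable).symm
    _ ≤ _ := by
        refine ENNReal.tsum_le_tsum fun w => ?_
        set x := vact (intVec w) g
        by_cases h : ∃ j ∈ Finset.range J, x - (j : ℝ) • u ∈ cube n m ∩ W
        · obtain ⟨j, hj, hx⟩ := h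
          rw [Finset.sum_eq_single_of_mem j hj, Set.indicator_of_mem hx, Set.indicator_of_mem]
          · rfl
          · rw [mem_cube]
            intro i
            have h1 := mem_cube.1 hx.1 i
            have h2 : x i = (x - (j : ℝ) • u) i + (j : ℝ) * u i := by simp
            rw [h2]
            refine (abs_add_le _ _).trans ?_
            rw [abs_mul, Nat.abs_cast]
            push_cast
            refine add_le_add h1 (mul_le_mul ?_ (hr i) (abs_nonneg _) (by positivity))
            exact_mod_cast (Finset.mem_range.1 hj).le
          · intro l _ hl
            refine Set.indicator_of_notMem (fun hxl => h₀ ?_) _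
            have h3 := W.sub_mem hx.2 hxl.2
            have h4 : x - (j : ℝ) • u - (x - (l : ℝ) • u) = ((l : ℝ) - j) • u := by
              rw [sub_smul]
              abel
            rw [h4] at h3
            exact (W.smul_mem_iff (sub_ne_zero.2 (by exact_mod_cast hl))).1 h3
        · rw [Finset.sum_eq_zero]
          · exact zero_le
          · intro j hj
            exact Set.indicator_of_notMem (fun hx => h ⟨j, hj, hx⟩) _

theorem latN_cube_div_le (g : SLR n) {m : ℕ} (hm : 1 ≤ m) {l : ℕ} (hl : 1 ≤ l) :
    latN g (cube n (l * m : ℕ)) / (2 * m : ENNReal) ^ n ≤ (2 * l) ^ n * latN g (cube n 1) := by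
  refine ENNReal.div_le_of_le_mul ((latN_cube_le g _).trans ?_)
  rw [mul_right_comm, ← mul_pow]
  gcongr
  have : 1 ≤ l * m := Nat.mul_le_mul hl hm
  norm_cast
  nlinarith

theorem tendsto_latN_inter (g : SLR n) {W : Submodule ℝ (Fin n → ℝ)} (hW : W ≠ ⊤) :
    Tendsto (fun m : ℕ => latN g (cube n m ∩ W) / (2 * m : ENNReal) ^ n) atTop (𝓝 0) := by
  obtain ⟨w₀, h₀⟩ := exists_vact_notMem g hW
  set u := vact (intVec w₀) g with hu
  set r := ⌈‖u‖⌉₊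
  have hr : ∀ i, |u i| ≤ r := fun i => (norm_le_pi_norm u i).trans (Nat.le_ceil _)
  rw [ENNReal.tendsto_nhds_zero]
  intro ε hε
  set C : ENNReal := (2 * (2 : ℕ)) ^ n * latN g (cube n 1)
  have hC : C ≠ ⊤ := ENNReal.mul_ne_top (by finiteness) (latN_lt_top g (isBounded_cube 1)).ne
  obtain ⟨J, hJ⟩ := ENNReal.exists_nat_gt (ENNReal.div_ne_top hC hε.ne')
  have hJ0 : (J : ENNReal) ≠ 0 := (lt_of_le_of_lt zero_le hJ).ne'
  filter_upwards [eventually_ge_atTop (J * r), eventually_ge_atTop 1] with m hm hm1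
  have h1 : (J : ENNReal) * (latN g (cube n m ∩ W) / (2 * m : ENNReal) ^ n) ≤ C := by
    rw [← mul_div_assoc]
    refine le_trans ?_ (latN_cube_div_le g hm1 (l := 2) (by norm_num))
    refine ENNReal.div_le_div_right ((mul_latN_inter_le g h₀ hr J m).trans (latN_mono g ?_)) _
    refine fun x hx => mem_cube.2 fun i => (mem_cube.1 hx i).trans ?_
    exact_mod_cast (by omega : m + J * r ≤ 2 * m)
  have h2 : C ≤ J * ε := (ENNReal.div_le_iff_le_mul (Or.inl hε.ne') (Or.inr hJ0)).1 hJ.le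
  exact (ENNReal.mul_le_mul_iff_right hJ0 (ENNReal.natCast_ne_top J)).1 (h1.trans h2)

theorem tendsto_latN_diff (g : SLR n) {W : Submodule ℝ (Fin n → ℝ)} (hW : W ≠ ⊤) :
    Tendsto (fun m : ℕ => latN g (cube n m \ W) / (2 * m : ENNReal) ^ n) atTop (𝓝 1) := by
  have h := ENNReal.Tendsto.sub (tendsto_latN_cube g) (tendsto_latN_inter g hW)
    (Or.inl ENNReal.one_ne_top)
  rw [tsub_zero] at h
  refine h.congr' ?_
  filter_upwards [eventually_ge_atTop 1] with m hm
  have hm0 : (2 * m : ENNReal) ^ n ≠ 0 := pow_ne_zero _ (by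
    simp only [ne_eq, mul_eq_zero, OfNat.ofNat_ne_zero, Nat.cast_eq_zero, false_or]
    omega)
  refine ENNReal.sub_eq_of_eq_add ?_ ?_
  · exact ENNReal.div_ne_top
      (latN_lt_top g ((isBounded_cube _).subset Set.inter_subset_left)).ne hm0
  · rw [← ENNReal.add_div]
    congr 1
    unfold latN
    rw [← ENNReal.tsum_add]
    refine tsum_congr fun w => ?_
    by_cases h1 : vact (intVec w) g ∈ cube n m <;> by_cases h2 : vact (intVec w) g ∈ W <;>
      simp [Set.indicator, h1, h2]

end

section

open Filter Topology
variable {k n : ℕ} {μ : Measure (SLR n)} [μ.IsHaarMeasure] {F : Set (SLR n)}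

/-- The set of linearly independent integer `k`-tuples. -/
def liTup (n k : ℕ) : Set (Fin k → Fin n → ℤ) := {v | LinearIndependent ℝ (intTup v)}

theorem invTup_liTup : InvTup (liTup n k) := invTup_linearIndependent

theorem indepTup_liTup : IndepTup (liTup n k) := fun _ h => h

theorem linearIndependent_act_iff {y : Fin k → Fin n → ℝ} (g : SLR n) :
    LinearIndependent ℝ (act y g) ↔ LinearIndependent ℝ y := by
  refine ⟨fun h => ?_, fun h => linearIndependent_act h g⟩
  have := linearIndependent_act h g⁻¹
  rwa [← act_mul, mul_inv_cancel, act_one] at this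

theorem act_intTup_cons (w : Fin n → ℤ) (u : Fin k → Fin n → ℤ) (g : SLR n) :
    act (intTup (Fin.cons w u : Fin (k + 1) → Fin n → ℤ)) g =
      Fin.cons (vact (intVec w) g) (act (intTup u) g) := by
  funext i
  refine Fin.cases ?_ (fun i => ?_) i <;> simp [act, intTup, vact]

/-- Multiplication of a function of the tail of a tuple by the indicator of its head. -/
def headMul (φ : (Fin k → Fin n → ℝ) → ENNReal) (B : Set (Fin n → ℝ))
    (y : Fin (k + 1) → Fin n → ℝ) : ENNReal :=
  B.indicator 1 (y 0) * φ (Fin.tail y)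

theorem measurable_finTail : Measurable (Fin.tail : (Fin (k + 1) → Fin n → ℝ) → _) :=
  measurable_pi_lambda _ fun i => measurable_pi_apply i.succ

theorem measurable_headMul {φ : (Fin k → Fin n → ℝ) → ENNReal} (hφ : Measurable φ)
    {B : Set (Fin n → ℝ)} (hB : MeasurableSet B) : Measurable (headMul φ B) :=
  ((measurable_one.indicator hB).comp (measurable_pi_apply 0)).mul (hφ.comp measurable_finTail)

theorem lintegral_headMul {φ : (Fin k → Fin n → ℝ) → ENNReal} (hφ : Measurable φ)
    {B : Set (Fin n → ℝ)} (hB : MeasurableSet B) :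
    ∫⁻ y, headMul φ B y = volume B * ∫⁻ y, φ y := by
  rw [← padMeas_volume, SLR.padMeas, lintegral_map (measurable_headMul hφ hB) measurable_finCons]
  have : ∀ p : (Fin n → ℝ) × (Fin k → Fin n → ℝ),
      headMul φ B (Fin.cons p.1 p.2) = B.indicator 1 p.1 * φ p.2 := fun p => by
    simp [headMul]
  simp only [this]
  rw [lintegral_prod_mul (measurable_one.indicator hB).aemeasurable hφ.aemeasurable,
    lintegral_indicator_one hB]

theorem tsum_headMul (φ : (Fin k → Fin n → ℝ) → ENNReal) (B : Set (Fin n → ℝ)) (g : SLR n) :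
    ∑' v : liTup n (k + 1), headMul φ B (act (intTup v.1) g) =
      ∑' u : liTup n k, φ (act (intTup u.1) g) *
        latN g (B \ Submodule.span ℝ (Set.range (act (intTup u.1) g))) := by
  rw [tsum_subtype (liTup n (k + 1)) fun v => headMul φ B (act (intTup v) g),
    tsum_subtype (liTup n k) fun u => φ (act (intTup u) g) *
        latN g (B \ Submodule.span ℝ (Set.range (act (intTup u) g))),
    ← (Fin.consEquiv fun _ => Fin n → ℤ).tsum_eq]
  change ∑' c : (Fin n → ℤ) × (Fin k → Fin n → ℤ), (liTup n (k + 1)).indicator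
    (fun v => headMul φ B (act (intTup v) g)) (Fin.cons c.1 c.2) = _
  rw [ENNReal.tsum_prod (f := fun w u =>
      (liTup n (k + 1)).indicator (fun v => headMul φ B (act (intTup v) g)) (Fin.cons w u)),
    ENNReal.tsum_comm]
  refine tsum_congr fun u => ?_
  have hcons : ∀ w : Fin n → ℤ, (Fin.cons w u : Fin (k + 1) → Fin n → ℤ) ∈ liTup n (k + 1) ↔
      u ∈ liTup n k ∧ vact (intVec w) g ∉ Submodule.span ℝ (Set.range (act (intTup u) g)) := by
    intro w
    rw [liTup, Set.mem_ofPred_eq, ← linearIndependent_act_iff g, act_intTup_cons,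
      linearIndependent_finCons, linearIndependent_act_iff]
    rfl
  by_cases hu : u ∈ liTup n k
  · rw [Set.indicator_of_mem hu, latN, ← ENNReal.tsum_mul_left]
    refine tsum_congr fun w => ?_
    by_cases hw : vact (intVec w) g ∈ Submodule.span ℝ (Set.range (act (intTup u) g))
    · rw [Set.indicator_of_notMem, Set.indicator_of_notMem, mul_zero]
      · exact fun h => h.2 hw
      · exact fun h => ((hcons w).1 h).2 hw
    · have h1 := (hcons w).2 ⟨hu, hw⟩
      rw [Set.indicator_of_mem h1, headMul, act_intTup_cons, Fin.cons_zero, Fin.tail_cons, mul_comm]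
      congr 1
      by_cases hB : vact (intVec w) g ∈ B <;> simp [Set.indicator, hB, hw]
  · rw [Set.indicator_of_notMem hu, ENNReal.tsum_eq_zero]
    exact fun w => Set.indicator_of_notMem (fun h => hu ((hcons w).1 h).1) _

theorem span_range_ne_top (hk : k < n) (y : Fin k → Fin n → ℝ) :
    Submodule.span ℝ (Set.range y) ≠ ⊤ := by
  intro h
  have h1 := finrank_range_le_card (R := ℝ) y
  rw [Set.finrank, h, finrank_top, Module.finrank_fin_fun, Fintype.card_fin] at h1
  omega

theorem volume_cube_natCast (m : ℕ) : volume (cube n m) = (2 * m : ENNReal) ^ n := by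
  rw [volume_cube, ENNReal.ofReal_mul (by norm_num)]
  simp

theorem two_mul_pow_ne_zero {m : ℕ} (hm : 1 ≤ m) : (2 * m : ENNReal) ^ n ≠ 0 :=
  pow_ne_zero _ (by
    simp only [ne_eq, mul_eq_zero, OfNat.ofNat_ne_zero, Nat.cast_eq_zero, false_or]
    omega)

theorem lintegral_headMul_div (hF : IsFundamentalDomain (Gam n) F μ) (h1 : μ F = 1)
    (hk : k + 1 < n) {φ : (Fin k → Fin n → ℝ) → ENNReal} (hφ : Measurable φ) {m : ℕ} (hm : 1 ≤ m) :
    ∫⁻ g in F, (∑' v : liTup n (k + 1), headMul φ (cube n m) (act (intTup v.1) g)) /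
      (2 * m : ENNReal) ^ n ∂μ = siegelConst μ F (liTup n (k + 1)) * ∫⁻ y, φ y := by
  simp only [div_eq_mul_inv]
  rw [lintegral_mul_const _ (measurable_tsum_act _ (measurable_headMul hφ (measurableSet_cube _))),
    lintegral_tsum_act hF h1 hk invTup_liTup indepTup_liTup
      (measurable_headMul hφ (measurableSet_cube _)),
    lintegral_headMul hφ (measurableSet_cube _), volume_cube_natCast,
      mul_comm (_ ^ n) (lintegral _ _),
    ← mul_assoc, mul_assoc, ENNReal.mul_inv_cancel (two_mul_pow_ne_zero hm) (by finiteness),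
      mul_one]

theorem tsum_le_liminf_headMul (hk : k < n) (φ : (Fin k → Fin n → ℝ) → ENNReal) (g : SLR n) :
    ∑' u : liTup n k, φ (act (intTup u.1) g) ≤ liminf (fun m : ℕ =>
      (∑' v : liTup n (k + 1), headMul φ (cube n m) (act (intTup v.1) g)) /
        (2 * m : ENNReal) ^ n) atTop := by
  rw [ENNReal.tsum_eq_iSup_sum]
  refine iSup_le fun s => ?_
  have h : Tendsto (fun m : ℕ => ∑ u ∈ s, φ (act (intTup u.1) g) *
      (latN g (cube n m \ Submodule.span ℝ (Set.range (act (intTup u.1) g))) /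
        (2 * m : ENNReal) ^ n)) atTop (𝓝 (∑ u ∈ s, φ (act (intTup u.1) g))) := by
    refine tendsto_finsetSum _ fun u _ => ?_
    have := ENNReal.Tendsto.const_mul (a := φ (act (intTup u.1) g)) (tendsto_latN_diff g
      (span_range_ne_top hk (act (intTup u.1) g))) (Or.inl one_ne_zero)
    rwa [mul_one] at this
  rw [← h.liminf_eq]
  refine liminf_le_liminf (Eventually.of_forall fun m => ?_)
  rw [tsum_headMul, div_eq_mul_inv, ← ENNReal.tsum_mul_right]
  refine le_trans (le_of_eq (Finset.sum_congr rfl fun u _ => ?_)) (ENNReal.sum_le_tsum s)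
  rw [div_eq_mul_inv, mul_assoc]

theorem siegelConst_liTup_mul (hF : IsFundamentalDomain (Gam n) F μ) (h1 : μ F = 1) (hk : k < n) :
    ∫⁻ g in F, ∑' u : liTup n k, (Set.Icc 0 1).indicator (1 : (Fin k → Fin n → ℝ) → ENNReal)
      (act (intTup u.1) g) ∂μ = siegelConst μ F (liTup n k) := by
  rw [lintegral_tsum_act hF h1 hk invTup_liTup indepTup_liTup
    (measurable_one.indicator measurableSet_Icc), lintegral_indicator_one measurableSet_Icc,
    volume_Icc_tuples, mul_one]

theorem siegelConst_liTup_le_succ (hF : IsFundamentalDomain (Gam n) F μ) (h1 : μ F = 1)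
    (hk : k + 1 < n) : siegelConst μ F (liTup n k) ≤ siegelConst μ F (liTup n (k + 1)) := by
  set φ : (Fin k → Fin n → ℝ) → ENNReal := (Set.Icc 0 1).indicator 1
  have hφ : Measurable φ := measurable_one.indicator measurableSet_Icc
  have hφ1 : ∫⁻ y, φ y = 1 := by
    rw [lintegral_indicator_one measurableSet_Icc, volume_Icc_tuples]
  rw [← siegelConst_liTup_mul hF h1 (by omega)]
  refine (lintegral_mono fun g => tsum_le_liminf_headMul (by omega) φ g).trans ?_
  refine (lintegral_liminf_le fun m => (measurable_tsum_act _
    (measurable_headMul hφ (measurableSet_cube _))).div_const _).trans ?_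
  refine le_of_eq (Tendsto.liminf_eq (tendsto_const_nhds.congr' ?_))
  filter_upwards [eventually_ge_atTop 1] with m hm
  rw [lintegral_headMul_div hF h1 hk hφ hm, hφ1, mul_one]

theorem measurable_latN {A : Set (Fin n → ℝ)} (hA : MeasurableSet A) :
    Measurable fun g : SLR n => latN g A :=
  Measurable.tsum fun w => (measurable_one.indicator hA).comp
    ((measurable_pi_apply (0 : Fin 1)).comp (measurable_act_left (k := 1) fun _ => intVec w))

theorem siegelConst_liTup_succ_le (hF : IsFundamentalDomain (Gam n) F μ) (h1 : μ F = 1)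
    (hk : k + 1 < n) (hfin : ∫⁻ g in F, (∑' u : liTup n k, (Set.Icc 0 1).indicator
      (1 : (Fin k → Fin n → ℝ) → ENNReal) (act (intTup u.1) g)) * latN g (cube n 1) ∂μ ≠ ⊤) :
    siegelConst μ F (liTup n (k + 1)) ≤ siegelConst μ F (liTup n k) := by
  set φ : (Fin k → Fin n → ℝ) → ENNReal := (Set.Icc 0 1).indicator 1
  have hφ : Measurable φ := measurable_one.indicator measurableSet_Icc
  have hφ1 : ∫⁻ y, φ y = 1 := by
    rw [lintegral_indicator_one measurableSet_Icc, volume_Icc_tuples]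
  set Φ : SLR n → ENNReal := fun g => ∑' u : liTup n k, φ (act (intTup u.1) g) with hΦ
  have hΦm : Measurable Φ := measurable_tsum_act _ hφ
  set x : ℕ → SLR n → ENNReal := fun m g => latN g (cube n m) / (2 * m : ENNReal) ^ n with hx
  have hlim : Tendsto (fun m => ∫⁻ g in F, Φ g * x (m + 1) g ∂μ) atTop (𝓝 (∫⁻ g in F, Φ g ∂μ)) := by
    refine tendsto_lintegral_of_dominated_convergence
      (fun g => (2 * (1 : ℕ)) ^ n * (Φ g * latN g (cube n 1))) (fun m => ?_) (fun m => ?_) ?_ ?_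
    · exact hΦm.mul ((measurable_latN (measurableSet_cube _)).div_const _)
    · refine Eventually.of_forall fun g => ?_
      dsimp only
      rw [mul_left_comm]
      gcongr
      have := latN_cube_div_le g (m := m + 1) (by omega) (l := 1) le_rfl
      rwa [one_mul] at this
    · rw [lintegral_const_mul (f := fun g => Φ g * latN g (cube n 1)) _ (hΦm.mul (measurable_latN
        (measurableSet_cube _)))]
      exact ENNReal.mul_ne_top (by finiteness) hfin
    · refine Eventually.of_forall fun g => ?_
      have := ENNReal.Tendsto.const_mul (a := Φ g) ((tendsto_latN_cube g).comp
        (tendsto_add_atTop_nat 1)) (Or.inl one_ne_zero)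
      rw [mul_one] at this
      exact this
  rw [← siegelConst_liTup_mul hF h1 (by omega : k < n)]
  refine ge_of_tendsto' hlim fun m => ?_
  have h2 := lintegral_headMul_div hF h1 hk hφ (m := m + 1) (by omega)
  rw [hφ1, mul_one] at h2
  rw [← h2]
  refine lintegral_mono fun g => ?_
  dsimp only
  rw [hx]
  dsimp only
  rw [← mul_div_assoc]
  refine ENNReal.div_le_div_right ?_ _
  rw [tsum_headMul, hΦ, ← ENNReal.tsum_mul_right]
  exact ENNReal.tsum_le_tsum fun u => mul_le_mul_right (latN_mono g Set.sdiff_subset) _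

end

section

open Filter Topology
variable {k n : ℕ} {μ : Measure (SLR n)} [μ.IsHaarMeasure] {F : Set (SLR n)}

theorem siegelConst_liTup_mono (hF : IsFundamentalDomain (Gam n) F μ) (h1 : μ F = 1) {j : ℕ}
    (hkj : k ≤ j) (hj : j < n) : siegelConst μ F (liTup n k) ≤ siegelConst μ F (liTup n j) := by
  induction j, hkj using Nat.le_induction with
  | base => exact le_rfl
  | succ j _ ih => exact (ih (by omega)).trans (siegelConst_liTup_le_succ hF h1 hj)

theorem siegelConst_liTup_lt_top (hF : IsFundamentalDomain (Gam n) F μ) (h1 : μ F = 1)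
    (hk : k < n) : siegelConst μ F (liTup n k) < ⊤ := by
  obtain ⟨m, rfl⟩ : ∃ m, n = m + 1 := ⟨n - 1, by omega⟩
  refine lt_of_le_of_lt (siegelConst_liTup_mono hF h1 (Nat.lt_succ_iff.1 hk)
    (Nat.lt_succ_self m)) ?_
  have h : liTup (m + 1) m = frameTup m 0 := by
    ext v
    exact ⟨fun h => ⟨h, 1, fun i hi => absurd hi (Nat.not_lt_zero _)⟩, fun h => h.1⟩
  rw [h]
  exact siegelConst_frameTup_lt_top hF h1 (siegelConst_prim_lt_top hF h1)

theorem tsum_liTup_zero_indicator (g : SLR n) :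
    ∑' u : liTup n 0, (Set.Icc 0 1).indicator
      (1 : (Fin 0 → Fin n → ℝ) → ENNReal) (act (intTup u.1) g) = 1 := by
  rw [tsum_eq_single ⟨0, linearIndependent_empty_type⟩]
  · rw [Set.indicator_of_mem]
    · rfl
    · exact ⟨fun i => i.elim0, fun i => i.elim0⟩
  · exact fun u hu => absurd (Subtype.ext (Subsingleton.elim _ _)) hu

theorem siegelConst_liTup_zero (hF : IsFundamentalDomain (Gam n) F μ) (h1 : μ F = 1)
    (hn : 0 < n) : siegelConst μ F (liTup n 0) = 1 := by
  rw [← siegelConst_liTup_mul hF h1 hn]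
  simp only [tsum_liTup_zero_indicator]
  rw [lintegral_one, Measure.restrict_apply_univ, h1]

theorem tsum_liTup_one (f : (Fin n → ℝ) → ENNReal) (g : SLR n) :
    ∑' u : liTup n 1, f (act (intTup u.1) g 0) =
      ∑' w : {w : Fin n → ℤ // w ≠ 0}, f (vact (intVec w.1) g) := by
  have hiff : ∀ u : Fin 1 → Fin n → ℤ, u ∈ liTup n 1 ↔ u 0 ≠ 0 := by
    intro u
    rw [liTup, Set.mem_ofPred_eq, linearIndependent_unique_iff]
    refine not_congr ⟨fun h => funext fun i => ?_, fun h => funext fun i => ?_⟩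
    · have := congrFun h i
      simpa [intTup, intVec] using this
    · simp [intTup, intVec, h]
  let e : liTup n 1 ≃ {w : Fin n → ℤ // w ≠ 0} :=
    (Equiv.funUnique (Fin 1) (Fin n → ℤ)).subtypeEquiv hiff
  rw [← e.tsum_eq]
  rfl

theorem lintegral_tsum_ne_zero (hF : IsFundamentalDomain (Gam n) F μ) (h1 : μ F = 1)
    (hn : 1 < n) {f : (Fin n → ℝ) → ENNReal} (hf : Measurable f) :
    ∫⁻ g in F, ∑' w : {w : Fin n → ℤ // w ≠ 0}, f (vact (intVec w.1) g) ∂μ =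
      siegelConst μ F (liTup n 1) * ∫⁻ z, f z := by
  simp only [← tsum_liTup_one]
  rw [lintegral_tsum_act hF h1 hn invTup_liTup indepTup_liTup
    (f := fun y => f (y 0)) (hf.comp (measurable_pi_apply 0))]
  congr 1
  exact (volume_preserving_funUnique (Fin 1) (Fin n → ℝ)).lintegral_comp hf

/-- The number of non-zero lattice points in a set. -/
def starN (g : SLR n) (A : Set (Fin n → ℝ)) : ENNReal :=
  ∑' w : {w : Fin n → ℤ // w ≠ 0}, A.indicator 1 (vact (intVec w.1) g)

theorem tsum_eq_tsum_add_compl {α : Type*} (f : α → ENNReal) (s : Set α) :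
    ∑' x, f x = ∑' x : s, f x + ∑' x : (sᶜ : Set α), f x := by
  rw [tsum_subtype, tsum_subtype, ← ENNReal.tsum_add]
  refine tsum_congr fun x => ?_
  by_cases h : x ∈ s <;> simp [h]

theorem latN_eq_starN_add (g : SLR n) (A : Set (Fin n → ℝ)) :
    latN g A = starN g A + A.indicator 1 0 := by
  rw [latN, tsum_eq_tsum_add_compl _ {w : Fin n → ℤ | w ≠ 0}]
  congr 1
  have h0 : vact (intVec (0 : Fin n → ℤ)) g = 0 := by
    have : intVec (0 : Fin n → ℤ) = 0 := by
      funext i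
      simp [intVec]
    rw [this, vact, Matrix.zero_vecMul]
  rw [tsum_eq_single ⟨0, by simp⟩]
  · rw [h0]
  · intro b hb
    exact absurd (Subtype.ext (by simpa using b.2)) hb

theorem starN_le_latN (g : SLR n) (A : Set (Fin n → ℝ)) : starN g A ≤ latN g A := by
  rw [latN_eq_starN_add]
  exact le_self_add

theorem measurable_starN {A : Set (Fin n → ℝ)} (hA : MeasurableSet A) :
    Measurable fun g : SLR n => starN g A :=
  Measurable.tsum fun w => (measurable_one.indicator hA).comp
    ((measurable_pi_apply (0 : Fin 1)).comp (measurable_act_left (k := 1) fun _ => intVec w.1))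

theorem lintegral_starN (hF : IsFundamentalDomain (Gam n) F μ) (h1 : μ F = 1) (hn : 1 < n)
    {A : Set (Fin n → ℝ)} (hA : MeasurableSet A) :
    ∫⁻ g in F, starN g A ∂μ = siegelConst μ F (liTup n 1) * volume A := by
  unfold starN
  rw [lintegral_tsum_ne_zero hF h1 hn (measurable_one.indicator hA), lintegral_indicator_one hA]

theorem exists_common_multiple {w w' : Fin n → ℤ} (hw : w ≠ 0) (hw' : w' ≠ 0)
    (h : ¬ LinearIndependent ℝ (intTup ![w, w'])) :
    ∃ (a b : {a : ℤ // a ≠ 0}) (u : {u : Fin n → ℤ // u ≠ 0}), w = a.1 • u.1 ∧ w' = b.1 • u.1 := by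
  have hminor : ∀ i j, w i * w' j = w j * w' i := by
    intro i j
    have e : intTup ![w, w'] = ![intVec w, intVec w'] := by
      funext l
      fin_cases l <;> rfl
    rw [e, LinearIndependent.pair_iff] at h
    push Not at h
    obtain ⟨s, t, hst, hne⟩ := h
    have hi : s * w i + t * w' i = 0 := congrFun hst i
    have hj : s * w j + t * w' j = 0 := congrFun hst j
    have h1 : s * (w i * w' j - w j * w' i : ℝ) = 0 := by
      linear_combination (w' j : ℝ) * hi - w' i * hj
    have h2 : t * (w i * w' j - w j * w' i : ℝ) = 0 := by
      linear_combination (w i : ℝ) * hj - w j * hi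
    have h3 : (w i * w' j - w j * w' i : ℝ) = 0 := by
      by_contra h4
      exact hne ((mul_eq_zero.1 h1).resolve_right h4) ((mul_eq_zero.1 h2).resolve_right h4)
    have h5 : (w i * w' j : ℝ) = w j * w' i := by linarith
    exact_mod_cast h5
  obtain ⟨i, hi⟩ := Function.ne_iff.1 hw
  rw [Pi.zero_apply] at hi
  obtain ⟨a, b, hab, ha, hb⟩ := Int.exists_gcd_one (m := w i) (n := w' i)
    (Int.gcd_pos_of_ne_zero_left _ hi)
  set d : ℤ := ((w i).gcd (w' i) : ℤ)
  have hd : d ≠ 0 := fun h0 => hi (by rw [ha, h0, mul_zero])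
  have ha0 : a ≠ 0 := fun h0 => hi (by rw [ha, h0, zero_mul])
  have hrel : ∀ j, a * w' j = b * w j := by
    intro j
    have := hminor i j
    rw [ha, hb] at this
    exact mul_left_cancel₀ hd (by linear_combination this)
  have hdvd : ∀ j, a ∣ w j := fun j =>
    Int.dvd_of_dvd_mul_right_of_gcd_one (Dvd.intro _ (hrel j)) hab
  choose u hu using hdvd
  have hwu : w = a • u := funext hu
  have hwu' : w' = b • u := funext fun j => mul_left_cancel₀ ha0 (by
    rw [hrel, hu, Pi.smul_apply, smul_eq_mul]
    ring)
  refine ⟨⟨a, ha0⟩, ⟨b, fun h0 => hw' ?_⟩, ⟨u, fun h0 => hw ?_⟩, hwu, hwu'⟩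
  · rw [hwu', h0, zero_smul]
  · rw [hwu, h0, smul_zero]

theorem intVec_zsmul (a : ℤ) (z : Fin n → ℤ) : intVec (a • z) = (a : ℝ) • intVec z := by
  funext i
  simp [intVec]

theorem starN_sq_le (g : SLR n) (A : Set (Fin n → ℝ)) :
    starN g A ^ 2 ≤ ∑' v : liTup n 2, headMul (headMul (fun _ => 1) A) A (act (intTup v.1) g) +
      ∑' (a : {a : ℤ // a ≠ 0}) (b : {b : ℤ // b ≠ 0}) (u : {u : Fin n → ℤ // u ≠ 0}),
        A.indicator 1 ((a.1 : ℝ) • vact (intVec u.1) g) *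
          A.indicator 1 ((b.1 : ℝ) • vact (intVec u.1) g) := by
  let Z := {w : Fin n → ℤ // w ≠ 0}
  let S := {a : ℤ // a ≠ 0}
  set χ : (Fin n → ℝ) → ENNReal := A.indicator 1
  set P : Z × Z → ENNReal := fun p => χ (vact (intVec p.1.1) g) * χ (vact (intVec p.2.1) g)
  have h0 : starN g A ^ 2 = ∑' p : Z × Z, P p := by
    rw [ENNReal.tsum_prod (f := fun w w' : Z => χ (vact (intVec w.1) g) * χ (vact (intVec w'.1) g)),
      sq, starN, ← ENNReal.tsum_mul_right]
    simp only [ENNReal.tsum_mul_left]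
    rfl
  set s : Set (Z × Z) := {p | LinearIndependent ℝ (intTup ![p.1.1, p.2.1])}
  rw [h0, tsum_eq_tsum_add_compl P s]
  refine add_le_add ?_ ?_
  · let ι : s → liTup n 2 := fun p => ⟨![p.1.1.1, p.1.2.1], p.2⟩
    have hι : Function.Injective ι := by
      intro p q hpq
      have h := congrArg Subtype.val hpq
      exact Subtype.ext (Prod.ext (Subtype.ext (congrFun h 0)) (Subtype.ext (congrFun h 1)))
    refine le_trans (le_of_eq (tsum_congr fun p => ?_)) (ENNReal.tsum_comp_le_tsum_of_injective hι
      fun v => headMul (headMul (fun _ => 1) A) A (act (intTup v.1) g))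
    simp only [headMul, mul_one]
    rfl
  · choose a b u hau hbu using fun p : (sᶜ : Set (Z × Z)) =>
      exists_common_multiple p.1.1.2 p.1.2.2 p.2
    let ι : (sᶜ : Set (Z × Z)) → S × S × Z := fun p => (a p, b p, u p)
    have hι : Function.Injective ι := by
      intro p q hpq
      simp only [ι, Prod.mk.injEq] at hpq
      refine Subtype.ext (Prod.ext (Subtype.ext ?_) (Subtype.ext ?_))
      · rw [hau p, hau q, hpq.1, hpq.2.2]
      · rw [hbu p, hbu q, hpq.2.1, hpq.2.2]
    have h2 := ENNReal.tsum_comp_le_tsum_of_injective hι fun t : S × S × Z =>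
      χ ((t.1.1 : ℝ) • vact (intVec t.2.2.1) g) * χ ((t.2.1.1 : ℝ) • vact (intVec t.2.2.1) g)
    rw [ENNReal.tsum_prod', ] at h2
    simp only [ENNReal.tsum_prod' (α := S) (β := Z)] at h2
    refine le_trans (le_of_eq (tsum_congr fun p => ?_)) h2
    simp only [ι, P, ← vact_smul, ← intVec_zsmul]
    rw [← hau p, ← hbu p]

/-- The constant controlling pairs of proportional lattice points. -/
def depConst (n : ℕ) : ENNReal :=
  2 * ∑' a : {a : ℤ // a ≠ 0}, 3 * ((a.1.natAbs : ENNReal) ^ 1 * ENNReal.ofReal (|(a.1 : ℝ)| ^ n)⁻¹)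

theorem depConst_lt_top (hn : 3 ≤ n) : depConst n < ⊤ := by
  rw [depConst, ENNReal.tsum_mul_left]
  exact ENNReal.mul_lt_top (by simp) (ENNReal.mul_lt_top (by simp) (tsum_int_pow_inv_lt_top hn))

theorem tsum_natAbs_le (a : {a : ℤ // a ≠ 0}) (c : ENNReal) :
    ∑' b : {b : ℤ // b ≠ 0}, (if b.1.natAbs ≤ a.1.natAbs then c else 0) ≤
      3 * ((a.1.natAbs : ENNReal) ^ 1 * c) := by
  set N := a.1.natAbs with hN
  have hN1 : 1 ≤ N := Int.natAbs_pos.2 a.2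
  refine (ENNReal.tsum_comp_le_tsum_of_injective Subtype.val_injective
    fun b : ℤ => if b.natAbs ≤ N then c else 0).trans ?_
  rw [tsum_eq_sum (s := Finset.Icc (-(N : ℤ)) N)]
  · refine (Finset.sum_le_card_nsmul _ _ c fun b _ => ?_).trans ?_
    · split_ifs
      · exact le_rfl
      · exact zero_le
    · rw [Int.card_Icc, nsmul_eq_mul, pow_one, ← mul_assoc]
      gcongr
      have : ((N : ℤ) + 1 - -(N : ℤ)).toNat ≤ 3 * N := by omega
      exact_mod_cast this
  · intro b hb
    rw [if_neg]
    intro h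
    exact hb (Finset.mem_Icc.2 (by omega))

theorem lintegral_indicator_smul {A : Set (Fin n → ℝ)} (hA : MeasurableSet A)
    (a : {a : ℤ // a ≠ 0}) :
    ∫⁻ z : Fin n → ℝ, A.indicator (1 : (Fin n → ℝ) → ENNReal) ((a.1 : ℝ) • z) =
      ENNReal.ofReal (|(a.1 : ℝ)| ^ n)⁻¹ * volume A := by
  have h := lintegral_smul_add (h := A.indicator (1 : (Fin n → ℝ) → ENNReal))
    (measurable_one.indicator hA) (d := (a.1 : ℝ)) (by exact_mod_cast a.2) 0
  simp only [add_zero] at h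
  rw [h, lintegral_indicator_one hA]

theorem tsum_lintegral_indicator_le {A : Set (Fin n → ℝ)} (hA : MeasurableSet A) :
    ∑' (a : {a : ℤ // a ≠ 0}) (b : {b : ℤ // b ≠ 0}), ∫⁻ z : Fin n → ℝ,
      A.indicator (1 : (Fin n → ℝ) → ENNReal) ((a.1 : ℝ) • z) *
        A.indicator (1 : (Fin n → ℝ) → ENNReal) ((b.1 : ℝ) • z) ≤ depConst n * volume A := by
  set t : {a : ℤ // a ≠ 0} → ENNReal := fun a => ENNReal.ofReal (|(a.1 : ℝ)| ^ n)⁻¹ with ht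
  have hle : ∀ a b : {a : ℤ // a ≠ 0}, ∫⁻ z : Fin n → ℝ,
      A.indicator (1 : (Fin n → ℝ) → ENNReal) ((a.1 : ℝ) • z) *
        A.indicator (1 : (Fin n → ℝ) → ENNReal) ((b.1 : ℝ) • z) ≤
      (if b.1.natAbs ≤ a.1.natAbs then t a * volume A else 0) +
        (if a.1.natAbs ≤ b.1.natAbs then t b * volume A else 0) := by
    intro a b
    have hone : ∀ z, A.indicator (1 : (Fin n → ℝ) → ENNReal) z ≤ 1 := fun z =>
      Set.indicator_apply_le' (fun _ => le_rfl) fun _ => zero_le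
    rcases le_total b.1.natAbs a.1.natAbs with h | h
    · rw [if_pos h, ← lintegral_indicator_smul hA a]
      exact le_add_right (lintegral_mono fun z => mul_le_of_le_one_right' (hone _))
    · rw [if_pos h, ← lintegral_indicator_smul hA b]
      exact le_add_left (lintegral_mono fun z => mul_le_of_le_one_left' (hone _))
  have hsum : ∑' a : {a : ℤ // a ≠ 0}, ∑' b : {b : ℤ // b ≠ 0},
      (if b.1.natAbs ≤ a.1.natAbs then t a * volume A else 0) ≤
      (∑' a : {a : ℤ // a ≠ 0}, 3 * ((a.1.natAbs : ENNReal) ^ 1 * t a)) * volume A := by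
    rw [← ENNReal.tsum_mul_right]
    refine ENNReal.tsum_le_tsum fun a => (tsum_natAbs_le a _).trans (le_of_eq ?_)
    ring
  refine (ENNReal.tsum_le_tsum fun a => ENNReal.tsum_le_tsum fun b => hle a b).trans ?_
  simp only [ENNReal.tsum_add]
  rw [ENNReal.tsum_comm (f := fun a b : {a : ℤ // a ≠ 0} =>
    if a.1.natAbs ≤ b.1.natAbs then t b * volume A else 0), depConst, mul_assoc, two_mul]
  exact add_le_add hsum hsum

theorem lintegral_starN_sq_le (hF : IsFundamentalDomain (Gam n) F μ) (h1 : μ F = 1) (hn : 2 < n)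
    {A : Set (Fin n → ℝ)} (hA : MeasurableSet A) :
    ∫⁻ g in F, starN g A ^ 2 ∂μ ≤ siegelConst μ F (liTup n 2) * volume A ^ 2 +
      siegelConst μ F (liTup n 1) * (depConst n * volume A) := by
  have hm0 : Measurable (headMul (k := 0) (n := n) (fun _ => 1) A) :=
    measurable_headMul measurable_const hA
  refine (lintegral_mono fun g => starN_sq_le g A).trans ?_
  rw [lintegral_add_left (measurable_tsum_act _ (measurable_headMul hm0 hA))]
  refine add_le_add (le_of_eq ?_) ?_
  · rw [lintegral_tsum_act hF h1 hn invTup_liTup indepTup_liTup (measurable_headMul hm0 hA),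
      lintegral_headMul hm0 hA, lintegral_headMul measurable_const hA, lintegral_one,
      Measure.volume_pi_eq_dirac (fun i : Fin 0 => i.elim0), measure_univ, mul_one, sq]
  · have hm : ∀ a b : {a : ℤ // a ≠ 0}, Measurable fun z : Fin n → ℝ =>
        A.indicator (1 : (Fin n → ℝ) → ENNReal) ((a.1 : ℝ) • z) *
          A.indicator (1 : (Fin n → ℝ) → ENNReal) ((b.1 : ℝ) • z) := fun a b =>
      ((measurable_one.indicator hA).comp (measurable_const_smul _)).mul
        ((measurable_one.indicator hA).comp (measurable_const_smul _))
    have hmv : ∀ u : Fin n → ℤ, Measurable fun g : SLR n => vact (intVec u) g := fun u =>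
      (measurable_pi_apply (0 : Fin 1)).comp (measurable_act_left (k := 1) fun _ => intVec u)
    have hm2 : ∀ a b : {a : ℤ // a ≠ 0}, Measurable fun g : SLR n =>
        ∑' u : {u : Fin n → ℤ // u ≠ 0},
        A.indicator (1 : (Fin n → ℝ) → ENNReal) ((a.1 : ℝ) • vact (intVec u.1) g) *
          A.indicator (1 : (Fin n → ℝ) → ENNReal) ((b.1 : ℝ) • vact (intVec u.1) g) := fun a b =>
      Measurable.tsum fun u => (hm a b).comp (hmv u.1)
    rw [lintegral_tsum fun a => (Measurable.tsum fun b => hm2 a b).aemeasurable]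
    refine le_trans (le_of_eq ?_) (mul_le_mul_right (tsum_lintegral_indicator_le hA) _)
    rw [← ENNReal.tsum_mul_left]
    refine tsum_congr fun a => ?_
    rw [lintegral_tsum fun b => (hm2 a b).aemeasurable, ← ENNReal.tsum_mul_left]
    exact tsum_congr fun b => lintegral_tsum_ne_zero hF h1 (by omega) (hm a b)

end

section

open Filter Topology
open scoped Pointwise
variable {k n : ℕ} {μ : Measure (SLR n)} [μ.IsHaarMeasure] {F : Set (SLR n)}

theorem latN_le_starN_add_one (g : SLR n) (A : Set (Fin n → ℝ)) : latN g A ≤ starN g A + 1 := by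
  rw [latN_eq_starN_add]
  gcongr
  exact Set.indicator_le_self' (s := A) (f := (1 : (Fin n → ℝ) → ENNReal)) (by simp) 0

theorem lintegral_starN_lt_top (hF : IsFundamentalDomain (Gam n) F μ) (h1 : μ F = 1) (hn : 1 < n)
    {A : Set (Fin n → ℝ)} (hA : MeasurableSet A) (hA' : volume A < ⊤) :
    ∫⁻ g in F, starN g A ∂μ < ⊤ := by
  rw [lintegral_starN hF h1 hn hA]
  exact ENNReal.mul_lt_top (siegelConst_liTup_lt_top hF h1 hn) hA'

theorem siegelConst_liTup_one (hF : IsFundamentalDomain (Gam n) F μ) (h1 : μ F = 1)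
    (hn : 1 < n) : siegelConst μ F (liTup n 1) = 1 := by
  rw [← siegelConst_liTup_zero hF h1 (by omega)]
  refine le_antisymm (siegelConst_liTup_succ_le hF h1 hn ?_)
    (siegelConst_liTup_mono hF h1 zero_le_one hn)
  simp only [tsum_liTup_zero_indicator, one_mul]
  refine ne_of_lt ((lintegral_mono fun g => latN_le_starN_add_one g _).trans_lt ?_)
  rw [lintegral_add_left (measurable_starN (measurableSet_cube 1)), lintegral_one,
    Measure.restrict_apply_univ, h1]
  exact ENNReal.add_lt_top.2 ⟨lintegral_starN_lt_top hF h1 hn (measurableSet_cube 1)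
    (isBounded_cube 1).measure_lt_top, ENNReal.one_lt_top⟩

theorem tsum_liTup_one_indicator_le (g : SLR n) :
    ∑' u : liTup n 1, (Set.Icc 0 1).indicator
      (1 : (Fin 1 → Fin n → ℝ) → ENNReal) (act (intTup u.1) g) ≤ starN g (cube n 1) := by
  rw [starN, ← tsum_liTup_one fun x => (cube n 1).indicator 1 x]
  refine ENNReal.tsum_le_tsum fun u => ?_
  refine Set.indicator_le (s := Set.Icc 0 1)
    (g := fun y : Fin 1 → Fin n → ℝ => (cube n 1).indicator (1 : (Fin n → ℝ) → ENNReal) (y 0))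
    (fun y hy => ?_) _
  have : y 0 ∈ cube n 1 := mem_cube.2 fun i =>
    abs_le.2 ⟨by linarith [show (0 : ℝ) ≤ y 0 i from hy.1 0 i], hy.2 0 i⟩
  rw [Set.indicator_of_mem this]
  exact le_rfl

theorem siegelConst_liTup_two (hF : IsFundamentalDomain (Gam n) F μ) (h1 : μ F = 1)
    (hn : 2 < n) : siegelConst μ F (liTup n 2) = 1 := by
  have hc : MeasurableSet (cube n 1) := measurableSet_cube 1
  have hv : volume (cube n 1) < ⊤ := (isBounded_cube 1).measure_lt_top
  have h11 := siegelConst_liTup_one hF h1 (show 1 < n by omega)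
  refine le_antisymm ?_ (h11.symm.le.trans (siegelConst_liTup_mono hF h1 one_le_two hn))
  refine le_of_le_of_eq (siegelConst_liTup_succ_le hF h1 hn ?_) h11
  refine ne_of_lt ((lintegral_mono fun g => mul_le_mul' (tsum_liTup_one_indicator_le g)
    (latN_le_starN_add_one g _)).trans_lt ?_)
  simp only [mul_add, mul_one, ← sq]
  rw [lintegral_add_right _ (measurable_starN hc)]
  refine ENNReal.add_lt_top.2 ⟨(lintegral_starN_sq_le hF h1 hn hc).trans_lt ?_,
    lintegral_starN_lt_top hF h1 (by omega) hc hv⟩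
  refine ENNReal.add_lt_top.2 ⟨ENNReal.mul_lt_top (siegelConst_liTup_lt_top hF h1 hn)
    (ENNReal.pow_lt_top hv), ?_⟩
  rw [h11, one_mul]
  exact ENNReal.mul_lt_top (depConst_lt_top hn) hv

theorem lintegral_starN_sub_sq_le (hF : IsFundamentalDomain (Gam n) F μ) (h1 : μ F = 1)
    (hn : 2 < n) {A : Set (Fin n → ℝ)} (hA : MeasurableSet A) (hb : Bornology.IsBounded A) :
    ∫⁻ g in F, ENNReal.ofReal (((starN g A).toReal - (volume A).toReal) ^ 2) ∂μ ≤
      depConst n * volume A := by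
  have hv : volume A < ⊤ := hb.measure_lt_top
  have hS := lintegral_starN_sq_le hF h1 hn hA
  have hE := lintegral_starN hF h1 (show 1 < n by omega) hA
  rw [siegelConst_liTup_one hF h1 (by omega), siegelConst_liTup_two hF h1 hn, one_mul,
    one_mul] at hS
  rw [siegelConst_liTup_one hF h1 (by omega), one_mul] at hE
  have hm := measurable_starN (n := n) hA
  have hpt : ∀ g : SLR n, ENNReal.ofReal (((starN g A).toReal - (volume A).toReal) ^ 2) +
      2 * volume A * starN g A = starN g A ^ 2 + volume A ^ 2 := by
    intro g
    have hs : starN g A ≠ ⊤ := ((starN_le_latN g A).trans_lt (latN_lt_top g hb)).ne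
    lift starN g A to NNReal using hs with x
    lift volume A to NNReal using hv.ne with V
    rw [← ENNReal.toReal_eq_toReal_iff' (by finiteness) (by finiteness),
      ENNReal.toReal_add (by finiteness) (by finiteness),
      ENNReal.toReal_add (by finiteness) (by finiteness), ENNReal.toReal_ofReal (sq_nonneg _)]
    simp
    ring
  have h_int := lintegral_congr (μ := μ.restrict F) hpt
  rw [lintegral_add_right _ (hm.const_mul _), lintegral_const_mul _ hm, hE,
    lintegral_add_left (hm.pow_const 2), lintegral_const, Measure.restrict_apply_univ, h1,
    mul_one] at h_int
  have h3 : 2 * volume A * volume A ≠ ⊤ := by finiteness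
  refine (ENNReal.add_le_add_iff_right h3).1 (h_int.le.trans ?_)
  refine (add_le_add_left hS _).trans (le_of_eq ?_)
  ring

theorem disc_eq (g : SLR n) {A : Set (Fin n → ℝ)} (hb : Bornology.IsBounded A) :
    disc g A = |(latN g A).toReal - (volume A).toReal| := by
  rw [latN_eq_natCard g hb]
  simp [disc, latCount, vact]

theorem measurable_disc {A : Set (Fin n → ℝ)} (hA : MeasurableSet A) (hb : Bornology.IsBounded A) :
    Measurable fun g : SLR n => disc g A := by
  simp only [disc_eq _ hb]
  exact (((measurable_latN hA).ennreal_toReal).sub_const _).norm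

theorem lintegral_disc_sq_le (hF : IsFundamentalDomain (Gam n) F μ) (h1 : μ F = 1)
    (hn : 2 < n) {A : Set (Fin n → ℝ)} (hA : MeasurableSet A) (hb : Bornology.IsBounded A) :
    ∫⁻ g in F, ENNReal.ofReal (disc g A ^ 2) ∂μ ≤ 2 * (depConst n * volume A) + 2 := by
  have hpt : ∀ g : SLR n, ENNReal.ofReal (disc g A ^ 2) ≤
      2 * ENNReal.ofReal (((starN g A).toReal - (volume A).toReal) ^ 2) + 2 := by
    intro g
    have hl : latN g A ≠ ⊤ := (latN_lt_top g hb).ne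
    have hs : starN g A ≠ ⊤ := ((starN_le_latN g A).trans_lt (latN_lt_top g hb)).ne
    have ha : (starN g A).toReal ≤ (latN g A).toReal := ENNReal.toReal_mono hl (starN_le_latN g A)
    have hb' : (latN g A).toReal ≤ (starN g A).toReal + 1 := by
      have := ENNReal.toReal_mono (by finiteness) (latN_le_starN_add_one g A)
      rwa [ENNReal.toReal_add hs ENNReal.one_ne_top, ENNReal.toReal_one] at this
    rw [disc_eq g hb, sq_abs]
    set x := (starN g A).toReal
    set y := (latN g A).toReal
    set V := (volume A).toReal
    have h : (y - V) ^ 2 ≤ 2 * (x - V) ^ 2 + 2 := by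
      nlinarith [sq_nonneg ((x - V) - (y - x))]
    refine (ENNReal.ofReal_le_ofReal h).trans (le_of_eq ?_)
    rw [ENNReal.ofReal_add (by positivity) (by norm_num), ENNReal.ofReal_mul (by norm_num)]
    simp
  refine (lintegral_mono hpt).trans ?_
  rw [lintegral_add_right _ measurable_const, lintegral_const_mul' _ _ (by simp), lintegral_const,
    Measure.restrict_apply_univ, h1, mul_one]
  gcongr
  exact lintegral_starN_sub_sq_le hF h1 hn hA hb

theorem measure_disc_ge_le (hF : IsFundamentalDomain (Gam n) F μ) (h1 : μ F = 1)
    (hn : 2 < n) {A : Set (Fin n → ℝ)} (hA : MeasurableSet A) (hb : Bornology.IsBounded A)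
    {T : ℝ} (hT : 0 < T) :
    μ.restrict F {g | T ≤ disc g A} ≤
      (2 * (depConst n * volume A) + 2) / ENNReal.ofReal (T ^ 2) := by
  have hT2 : 0 < T ^ 2 := by positivity
  rw [ENNReal.le_div_iff_mul_le (Or.inl (by simpa using hT.ne')) (Or.inl (by simp)), mul_comm]
  refine le_trans ?_ ((mul_meas_ge_le_lintegral
    ((measurable_disc hA hb).pow_const 2).ennreal_ofReal (ENNReal.ofReal (T ^ 2))).trans
    (lintegral_disc_sq_le hF h1 hn hA hb))
  gcongr
  exact fun h => ENNReal.ofReal_le_ofReal (pow_le_pow_left₀ hT.le h 2)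

theorem latN_gamma_mul (γ : Gam n) (g : SLR n) (A : Set (Fin n → ℝ)) :
    latN ((γ : SLR n) * g) A = latN g A := by
  have key : ∀ g' : SLR n, latN g' A = ∑' v : (Set.univ : Set (Fin 1 → Fin n → ℤ)),
      A.indicator (1 : (Fin n → ℝ) → ENNReal) (act (intTup v.1) g' 0) := by
    intro g'
    rw [tsum_univ (fun v : Fin 1 → Fin n → ℤ =>
      A.indicator (1 : (Fin n → ℝ) → ENNReal) (act (intTup v) g' 0)), latN,
      ← (Equiv.funUnique (Fin 1) (Fin n → ℤ)).tsum_eq]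
    rfl
  rw [key, key]
  exact tsum_act_gamma (fun _ _ _ => Set.mem_univ _)
    (fun y => A.indicator (1 : (Fin n → ℝ) → ENNReal) (y 0)) γ g

theorem finite_gamma_inter {L : Set (SLR n)} (hL : IsCompact L) :
    {γ : Gam n | (γ : SLR n) ∈ L}.Finite := by
  obtain ⟨R, hR⟩ := (hL.image continuous_rows).isBounded.subset_closedBall 0
  have h0 : {m : Fin n → Fin n → ℤ | ∀ i, m i ∈ {w | intVec w ∈ Metric.closedBall 0 R}}.Finite :=
    Set.Finite.pi' fun _ => finite_intVec_mem Metric.isBounded_closedBall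
  have h2 : {γ : Matrix.SpecialLinearGroup (Fin n) ℤ |
      Matrix.SpecialLinearGroup.map (Int.castRingHom ℝ) γ ∈ L}.Finite := by
    refine Set.Finite.subset (h0.preimage (f := fun γ : Matrix.SpecialLinearGroup (Fin n) ℤ =>
      fun i j => (γ : Matrix (Fin n) (Fin n) ℤ) i j) ?_) fun γ hγ i => ?_
    · exact fun a _ b _ h => Subtype.ext h
    · have := hR (Set.mem_image_of_mem rows hγ)
      rw [mem_closedBall_zero_iff] at this
      rw [Set.mem_ofPred_eq, mem_closedBall_zero_iff]
      exact (norm_le_pi_norm (rows (Matrix.SpecialLinearGroup.map (Int.castRingHom ℝ) γ)) i).trans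
        this
  refine (h2.image fun γ => (⟨_, γ, rfl⟩ : Gam n)).subset ?_
  rintro ⟨_, γ, rfl⟩ h
  exact ⟨γ, h, rfl⟩

/-- The number of elements of `SL_n(ℤ)` in a set. -/
def gamCount (L : Set (SLR n)) : ENNReal := ∑' γ : Gam n, L.indicator 1 (γ : SLR n)

theorem gamCount_lt_top {L : Set (SLR n)} (hL : IsCompact L) : gamCount L < ⊤ := by
  rw [gamCount, tsum_eq_sum (s := (finite_gamma_inter hL).toFinset)]
  · refine ENNReal.sum_lt_top.2 fun γ _ => lt_of_le_of_lt
      (Set.indicator_le_self' (s := L) (f := (1 : SLR n → ENNReal)) (by simp) _) (by simp)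
  · exact fun γ hγ => Set.indicator_of_notMem (by simpa using hγ) _

theorem tsum_indicator_inv_smul_le (K : Set (SLR n)) (x : SLR n) :
    ∑' γ : Gam n, K.indicator (1 : SLR n → ENNReal) (γ⁻¹ • x) ≤ gamCount (K * K⁻¹) := by
  by_cases h : ∃ γ₀ : Gam n, γ₀⁻¹ • x ∈ K
  · obtain ⟨γ₀, h0⟩ := h
    rw [gamCount, ← ((Equiv.inv (Gam n)).trans (Equiv.mulRight γ₀)).tsum_eq
      fun γ : Gam n => (K * K⁻¹).indicator (1 : SLR n → ENNReal) (γ : SLR n)]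
    refine ENNReal.tsum_le_tsum fun γ => ?_
    by_cases hγ : γ⁻¹ • x ∈ K
    · rw [Set.indicator_of_mem hγ, Set.indicator_of_mem]
      · rfl
      · refine ⟨_, hγ, _, Set.inv_mem_inv.2 h0, ?_⟩
        simp [Subgroup.smul_def]
    · rw [Set.indicator_of_notMem hγ]
      exact zero_le
  · push Not at h
    refine le_of_eq_of_le ?_ zero_le
    exact ENNReal.tsum_eq_zero.2 fun γ => Set.indicator_of_notMem (h γ) _

theorem measure_inter_le (hF : IsFundamentalDomain (Gam n) F μ) {K S : Set (SLR n)}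
    (hK : MeasurableSet K) (hS : MeasurableSet S) (hinv : ∀ (γ : Gam n) x, γ • x ∈ S ↔ x ∈ S) :
    μ (K ∩ S) ≤ gamCount (K * K⁻¹) * μ.restrict F S := by
  have hmK : Measurable (K.indicator (1 : SLR n → ENNReal)) := measurable_one.indicator hK
  have hmS : Measurable (S.indicator (1 : SLR n → ENNReal)) := measurable_one.indicator hS
  have hpt : ∀ (γ : Gam n) (x : SLR n), (K ∩ S).indicator (1 : SLR n → ENNReal) (γ⁻¹ • x) =
      K.indicator 1 (γ⁻¹ • x) * S.indicator 1 x := by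
    intro γ x
    by_cases h1 : γ⁻¹ • x ∈ K <;> by_cases h2 : x ∈ S <;> simp [Set.indicator, hinv, h1, h2]
  rw [← lintegral_indicator_one (hK.inter hS), hF.lintegral_eq_tsum']
  simp only [hpt]
  rw [← lintegral_tsum, ← lintegral_indicator_one hS, ← lintegral_const_mul _ hmS]
  · refine lintegral_mono fun x => ?_
    rw [ENNReal.tsum_mul_right]
    exact mul_le_mul_left (tsum_indicator_inv_smul_le K x) _
  · intro γ
    refine (Measurable.mul ?_ hmS).aemeasurable
    refine hmK.comp ?_
    exact (continuous_const.mul continuous_id).measurable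

theorem exists_measure_disc_le (hF : IsFundamentalDomain (Gam n) F μ) (h1 : μ F = 1)
    (hn : 3 ≤ n) {K : Set (SLR n)} (hK : IsCompact K) :
    ∃ C > (0 : ℝ), ∀ A : Set (Fin n → ℝ), MeasurableSet A → Bornology.IsBounded A →
      1 < (volume A).toReal → ∀ T : ℝ, 0 < T →
        μ {g ∈ K | T ≤ disc g A} ≤ ENNReal.ofReal (C * (volume A).toReal / T ^ 2) := by
  have hM := gamCount_lt_top (hK.mul hK.inv)
  have hD := depConst_lt_top hn
  set M := gamCount (K * K⁻¹)
  set D := depConst n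
  refine ⟨M.toReal * (2 * D.toReal + 2) + 1, by positivity, fun A hA hb hV T hT => ?_⟩
  have hv : volume A < ⊤ := hb.measure_lt_top
  have hS : MeasurableSet {g : SLR n | T ≤ disc g A} :=
    measurableSet_le measurable_const (measurable_disc hA hb)
  have h := measure_inter_le hF hK.measurableSet hS fun γ x => by
    rw [Set.mem_ofPred_eq, Set.mem_ofPred_eq, disc_eq _ hb, disc_eq _ hb, Subgroup.smul_def,
      smul_eq_mul, latN_gamma_mul]
  have h' := h.trans (mul_le_mul_right (measure_disc_ge_le hF h1 hn hA hb hT) M)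
  refine h'.trans ?_
  have hT2 : 0 < T ^ 2 := by positivity
  have hfin : M * ((2 * (D * volume A) + 2) / ENNReal.ofReal (T ^ 2)) ≠ ⊤ :=
    ENNReal.mul_ne_top hM.ne (ENNReal.div_ne_top (by finiteness) (by simpa using hT.ne'))
  rw [← ENNReal.ofReal_toReal hfin]
  refine ENNReal.ofReal_le_ofReal ?_
  rw [ENNReal.toReal_mul, ENNReal.toReal_div, ENNReal.toReal_ofReal hT2.le,
    ENNReal.toReal_add (by finiteness) (by finiteness), ENNReal.toReal_mul, ENNReal.toReal_mul,
    ENNReal.toReal_ofNat, ← mul_div_assoc]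
  refine div_le_div_of_nonneg_right ?_ hT2.le
  have hM0 : 0 ≤ M.toReal := ENNReal.toReal_nonneg
  nlinarith [mul_nonneg hM0 (sub_nonneg.2 hV.le)]

end

end SLR

/-- Lemma 2 of the paper: the measure of the set of `g` in a fixed compact set `𝒦` with
large discrepancy `D(ℤⁿg, A) ≥ T` is `O_𝒦(vol(A)/T²)`, for the Haar measure normalized so
that a fundamental domain for `SL_n(ℤ)` has measure one. -/
theorem measure_of_large_discrepancy
    (n : ℕ) (hn : 3 ≤ n) (K : Set (SLR n)) (hK : IsCompact K)
    (μ : Measure (SLR n)) [μ.IsHaarMeasure]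
    (hnorm : ∃ F : Set (SLR n), IsFundamentalDomain (Gam n) F μ ∧ μ F = 1) :
    ∃ C > (0 : ℝ), ∀ A : Set (Fin n → ℝ), MeasurableSet A → Bornology.IsBounded A →
      1 < (volume A).toReal → ∀ T : ℝ, 0 < T →
        μ {g ∈ K | T ≤ disc g A} ≤ ENNReal.ofReal (C * (volume A).toReal / T ^ 2) := by
  obtain ⟨F, hF, h1⟩ := hnorm
  exact SLR.exists_measure_disc_le hF h1 hn hK

end
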